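/- Single-point blow-up for the model system: under the stated hypotheses, blow-up occurs only at the origin; that is, for every point x in the ball with 0 < |x| < R one has sup_{0<t<T*} (u(t,x) + v(t,x)) < ∞. -/

import Mathlib

open Set Filter

structure Rad (n : ℕ) (R T d : ℝ) (w S : ℝ → ℝ → ℝ) : Prop where
  hd : 0 < d
  hn : 1 ≤ n
  hR : 0 < R
  nn : ∀ t ∈ Ico (0:ℝ) T, ∀ x ∈ Icc (0:ℝ) R, 0 ≤ w t x
  cont : ContinuousOn (Function.uncurry w) (Ico (0:ℝ) T ×ˢ Icc (0:ℝ) R)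
  d1 : ∀ t ∈ Ioo (0:ℝ) T, ∀ x ∈ Ioo (0:ℝ) R, HasDerivAt (w t) (deriv (w t) x) x
  d2 : ∀ t ∈ Ioo (0:ℝ) T, ∀ x ∈ Ioo (0:ℝ) R,
    HasDerivAt (deriv (w t)) (deriv (deriv (w t)) x) x
  dt : ∀ t ∈ Ioo (0:ℝ) T, ∀ x ∈ Ioo (0:ℝ) R, HasDerivAt (fun s => w s x)
    (d * (deriv (deriv (w t)) x + ((n:ℝ) - 1) / x * deriv (w t) x) + S t x) t
  bc : ∀ t ∈ Ioo (0:ℝ) T, w t R = 0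
  mono : ∀ t ∈ Ico (0:ℝ) T, AntitoneOn (w t) (Icc (0:ℝ) R)

lemma first_touch {X : Type*} [TopologicalSpace X] {K : Set X} (hK : IsCompact K) {a b : ℝ}
    {f : ℝ → X → ℝ} (hf : ContinuousOn (Function.uncurry f) (Icc a b ×ˢ K))
    (h0 : ∀ x ∈ K, 0 < f a x)
    (hno : ∀ t ∈ Ioc a b, ∀ x ∈ K, f t x = 0 → (∀ s ∈ Icc a t, ∀ y ∈ K, 0 ≤ f s y) → False) :
    ∀ t ∈ Icc a b, ∀ x ∈ K, 0 < f t x := by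
  by_contra! hcon
  obtain ⟨t1, ht1, x1, hx1, hfx1⟩ := hcon
  have hc : IsCompact (Icc a b ×ˢ K) := isCompact_Icc.prod hK
  have : CompactSpace (Icc a b ×ˢ K : Set (ℝ × X)) := isCompact_iff_compactSpace.mp hc
  have hf' := continuousOn_iff_continuous_domRestrict.mp hf
  set C : Set (Icc a b ×ˢ K : Set (ℝ × X)) := {z | (Icc a b ×ˢ K).domRestrict (Function.uncurry f) z ≤ 0} with hC
  have hCc : IsCompact C := (isClosed_le hf' continuous_const).isCompact
  have hCn : C.Nonempty := ⟨⟨(t1, x1), ⟨ht1, hx1⟩⟩, hfx1⟩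
  obtain ⟨z, hz, hmin⟩ := hCc.exists_isMinOn hCn
    (f := fun z : (Icc a b ×ˢ K : Set (ℝ × X)) => z.1.1) (by fun_prop)
  obtain ⟨⟨t, x⟩, ht, hx⟩ := z
  simp only at ht hx
  have hz' : f t x ≤ 0 := hz
  have hpos : ∀ s ∈ Ico a t, ∀ y ∈ K, 0 < f s y := by
    intro s hs y hy
    by_contra! hle
    have hm : (⟨(s, y), ⟨⟨hs.1, hs.2.le.trans ht.2⟩, hy⟩⟩ : (Icc a b ×ˢ K : Set (ℝ × X))) ∈ C := hle
    have := hmin hm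
    simp only [mem_ofPred_eq] at this
    exact absurd hs.2 (not_lt.mpr this)
  have hta : a < t := by
    rcases eq_or_lt_of_le ht.1 with h | h
    · subst h; exact absurd (h0 x hx) (not_lt.mpr hz')
    · exact h
  have hnn : ∀ s ∈ Icc a t, ∀ y ∈ K, 0 ≤ f s y := by
    intro s hs y hy
    rcases eq_or_lt_of_le hs.2 with h | h
    · subst h
      have hcy : ContinuousOn (fun r => f r y) (Icc a b) := by
        have : ContinuousOn (fun r : ℝ => (r, y)) (Icc a b) := by fun_prop
        exact hf.comp this (fun r hr => ⟨hr, hy⟩)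
      have h1 : ContinuousWithinAt (fun r => f r y) (Ioo a s) s :=
        (hcy s ht).mono (fun r hr => ⟨hr.1.le, hr.2.le.trans ht.2⟩)
      have hne : (nhdsWithin s (Ioo a s)).NeBot := by
        apply mem_closure_iff_nhdsWithin_neBot.mp
        rw [closure_Ioo hta.ne]; exact ⟨hta.le, le_rfl⟩
      exact ge_of_tendsto h1 (eventually_nhdsWithin_of_forall fun r hr => (hpos r ⟨hr.1.le, hr.2⟩ y hy).le)
    · exact (hpos s ⟨hs.1, h⟩ y hy).le
  exact hno t ⟨hta, ht.2⟩ x hx (le_antisymm hz' (hnn t ⟨hta.le, le_rfl⟩ x hx)) hnn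

/-- left time derivative condition -/
lemma left_deriv_nonpos {φ : ℝ → ℝ} {a t φ' : ℝ} (hat : a < t) (h : HasDerivAt φ φ' t)
    (h0 : φ t = 0) (hn : ∀ᶠ s in nhdsWithin t (Iio t), 0 ≤ φ s) : φ' ≤ 0 := by
  have h1 : Tendsto (slope φ t) (nhdsWithin t (Iio t)) (nhds φ') :=
    (hasDerivAt_iff_tendsto_slope.mp h).mono_left
    (nhdsWithin_mono t (fun s hs => (ne_of_lt (mem_Iio.mp hs) : s ≠ t)))
  refine le_of_tendsto (show Tendsto (slope φ t) (nhdsWithin t (Iio t)) (nhds φ') from h1) ?_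
  filter_upwards [hn, self_mem_nhdsWithin] with s hs hst
  rw [slope_def_field, h0]
  have : s - t < 0 := sub_neg.mpr hst
  apply div_nonpos_of_nonneg_of_nonpos <;> linarith

lemma second_deriv_nonneg {φ φ1 : ℝ → ℝ} {x φ2 : ℝ} (hm : IsLocalMin φ x)
    (h1 : ∀ᶠ y in nhds x, HasDerivAt φ (φ1 y) y) (h2 : HasDerivAt φ1 φ2 x) :
    φ1 x = 0 ∧ 0 ≤ φ2 := by
  have e0 : φ1 x = 0 := hm.hasDerivAt_eq_zero h1.self_of_nhds
  refine ⟨e0, ?_⟩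
  by_contra! hneg
  have hev : deriv φ =ᶠ[nhds x] φ1 := h1.mono fun y hy => hy.deriv
  have hdd : deriv (deriv φ) x = φ2 := by rw [hev.deriv_eq]; exact h2.deriv
  have hmax : IsLocalMax φ x := isLocalMax_of_deriv_deriv_neg (by rw [hdd]; exact hneg)
    (by rw [hev.self_of_nhds, e0]) h1.self_of_nhds.continuousAt
  have hconst : φ =ᶠ[nhds x] fun _ => φ x := by
    filter_upwards [hm, hmax] with y h1 h2 using le_antisymm h2 h1
  have : deriv (deriv φ) x = 0 := by
    rw [(hconst.deriv).deriv_eq]; simp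
  rw [hdd] at this; linarith

lemma bump_alg {N s y ℓ ρa : ℝ} {n : ℕ} (hn : 1 ≤ n) (hρ : 0 < ρa) (hy : ρa ≤ y)
    (hN : N = ((n:ℝ) - 1) / ρa) (hℓ : 0 < ℓ) (hℓ1 : ℓ ≤ 1) (hs : s ^ 2 ≤ 1) :
    -(((12 + 4 * N) ^ 2 / 32) / ℓ ^ 2) * (1 - s ^ 2) ^ 2 ≤
      (12 * s ^ 2 - 4) / ℓ ^ 2 + ((n:ℝ) - 1) / y * (-4 * s * (1 - s ^ 2) / ℓ) := by
  have hn' : (0:ℝ) ≤ (n:ℝ) - 1 := by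
    have : (1:ℝ) ≤ n := by exact_mod_cast hn
    linarith
  have hNy : ((n:ℝ) - 1) / y ≤ N := by rw [hN]; gcongr
  have hNy0 : 0 ≤ ((n:ℝ) - 1) / y := div_nonneg hn' (hρ.le.trans hy)
  set m := ((n:ℝ) - 1) / y
  have hsl : s * ℓ ≤ 1 := by
    have : s ≤ 1 := by nlinarith
    nlinarith
  have hω : 0 ≤ 1 - s ^ 2 := by linarith
  have h1 : m * (s * ℓ) ≤ N := by
    rcases le_or_gt 0 s with h | h
    · have := mul_nonneg h hℓ.le
      nlinarith
    · have : s * ℓ ≤ 0 := by nlinarith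
      nlinarith
  have e1 : -(((12 + 4 * N) ^ 2 / 32) / ℓ ^ 2) * (1 - s ^ 2) ^ 2
      = (-((12 + 4 * N) ^ 2 / 32) * (1 - s ^ 2) ^ 2) / ℓ ^ 2 := by ring
  have e2 : (12 * s ^ 2 - 4) / ℓ ^ 2 + m * (-4 * s * (1 - s ^ 2) / ℓ)
     = ((12 * s ^ 2 - 4) - 4 * (m * (s * ℓ)) * (1 - s ^ 2)) / ℓ ^ 2 := by
    field_simp
    ring
  rw [e1, e2]
  gcongr
  have : m * (s * ℓ) * (1 - s^2) ≤ N * (1 - s^2) := by gcongr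
  nlinarith [sq_nonneg ((12 + 4 * N) * (1 - s^2) - 16)]

set_option maxHeartbeats 1000000 in
lemma bump {n : ℕ} {R T d ρa : ℝ} {w S : ℝ → ℝ → ℝ} (H : Rad n R T d w S) (hρ : 0 < ρa) :
    ∃ c : ℝ, 0 < c ∧ c ≤ 1 ∧ ∀ x ℓ t0 s A B : ℝ, 0 < ℓ → ℓ ≤ 1 → ρa ≤ x - ℓ → x + ℓ ≤ R →
      0 ≤ t0 → 0 ≤ s → s ≤ ℓ ^ 2 → t0 + s < T → 0 ≤ A → 0 ≤ B →
      (∀ y ∈ Icc (x - ℓ) (x + ℓ), A ≤ w t0 y) →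
      (∀ t ∈ Icc t0 (t0 + s), ∀ y ∈ Icc (x - ℓ) (x + ℓ), B ≤ S t y) →
      c * (A + B * s) ≤ w (t0 + s) x := by
  obtain ⟨N, hN⟩ : ∃ N, N = ((n:ℝ) - 1) / ρa := ⟨_, rfl⟩
  have hd := H.hd
  obtain ⟨M0, hM0⟩ : ∃ M0, M0 = (12 + 4 * N) ^ 2 / 32 := ⟨_, rfl⟩
  have hM0p : 0 ≤ M0 := by rw [hM0]; positivity
  refine ⟨Real.exp (-(d * M0)), Real.exp_pos _, Real.exp_le_one_iff.mpr (by nlinarith [mul_nonneg hd.le hM0p]), ?_⟩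
  intro x ℓ t0 s A B hℓ hℓ1 hxa hxR ht0 hs hsℓ hsT hA hB hwA hSB
  -- general eta
  have key : ∀ η > 0, 0 < w (t0 + s) x - (A + B * s) * Real.exp (-(d * M0 / ℓ^2) * s) + η * (1 + s) := by
    intro η hη
    let b : ℝ → ℝ := fun t => (A + B * (t - t0)) * Real.exp (-(d * M0 / ℓ^2) * (t - t0))
    let φ : ℝ → ℝ := fun y => (1 - ((y - x) / ℓ) ^ 2) ^ 2
    have hb0 : ∀ t, t0 ≤ t → 0 ≤ b t := fun t ht => by
      have : 0 ≤ t - t0 := by linarith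
      simp only [b]; positivity
    let f : ℝ → ℝ → ℝ := fun t y => w t y - b t * φ y + η * (1 + (t - t0))
    have hsub : Icc (x - ℓ) (x + ℓ) ⊆ Icc 0 R := fun y hy => ⟨by linarith [hy.1], by linarith [hy.2]⟩
    have hf : ContinuousOn (Function.uncurry f) (Icc t0 (t0 + s) ×ˢ Icc (x - ℓ) (x + ℓ)) := by
      have h1 : ContinuousOn (Function.uncurry w) (Icc t0 (t0 + s) ×ˢ Icc (x - ℓ) (x + ℓ)) :=
        H.cont.mono (prod_mono (fun r hr => ⟨by linarith [hr.1], by linarith [hr.2]⟩) hsub)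
      have h2 : Continuous (fun z : ℝ × ℝ => - b z.1 * φ z.2 + η * (1 + (z.1 - t0))) := by
        simp only [b, φ]; fun_prop
      refine (h1.add h2.continuousOn).congr ?_
      rintro ⟨t, y⟩ _
      simp only [f, Function.uncurry, Pi.add_apply]; ring
    have hφ1 : ∀ y ∈ Icc (x - ℓ) (x + ℓ), ((y - x) / ℓ) ^ 2 ≤ 1 := by
      intro y hy
      rw [div_pow, div_le_one (by positivity)]
      apply sq_le_sq'
      · linarith [hy.1]
      · linarith [hy.2]
    have hφle : ∀ y ∈ Icc (x - ℓ) (x + ℓ), 0 ≤ φ y ∧ φ y ≤ 1 := by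
      intro y hy
      have := hφ1 y hy
      have h2 := sq_nonneg ((y - x) / ℓ)
      refine ⟨by simp only [φ]; positivity, ?_⟩
      simp only [φ]
      nlinarith
    have := first_touch (isCompact_Icc (a := x - ℓ) (b := x + ℓ)) (a := t0) (b := t0 + s) (f := f) hf ?_ ?_
      (t0 + s) ⟨by linarith, le_rfl⟩ x ⟨by linarith, by linarith⟩
    · simpa [f, b, φ] using this
    · intro y hy
      have h1 := hwA y hy
      have h2 := hφle y hy
      simp only [f, b, sub_self, mul_zero, add_zero, Real.exp_zero, mul_one]
      nlinarith
    · intro t ht y hy hft hnn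
      have htI : t ∈ Ioo (0:ℝ) T := ⟨by linarith [ht.1], by linarith [ht.2]⟩
      have hwn := H.nn t ⟨htI.1.le, htI.2⟩ y (hsub hy)
      have hηt : 0 < η * (1 + (t - t0)) := by have := ht.1; have : 0 < 1 + (t - t0) := by linarith
                                              positivity
      have hyo : y ∈ Ioo (x - ℓ) (x + ℓ) := by
        refine ⟨lt_of_le_of_ne hy.1 ?_, lt_of_le_of_ne hy.2 ?_⟩
        · rintro rfl
          have : φ (x - ℓ) = 0 := by simp only [φ]; field_simp; ring
          simp only [f, this] at hft
          linarith
        · rintro rfl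
          have : φ (x + ℓ) = 0 := by simp only [φ]; field_simp; ring
          simp only [f, this] at hft
          linarith
      have hyI : y ∈ Ioo (0:ℝ) R := ⟨by linarith [hyo.1], by linarith [hyo.2]⟩
      -- time derivative
      have hbt : HasDerivAt b (B * Real.exp (-(d * M0 / ℓ^2) * (t - t0)) +
          (A + B * (t - t0)) * (Real.exp (-(d * M0 / ℓ^2) * (t - t0)) * (-(d * M0 / ℓ^2)))) t := by
        have e1 : HasDerivAt (fun t => A + B * (t - t0)) B t := by
          simpa using (((hasDerivAt_id t).sub_const t0).const_mul B).const_add A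
        have e2 : HasDerivAt (fun t => -(d * M0 / ℓ^2) * (t - t0)) (-(d * M0 / ℓ^2)) t := by
          simpa using ((hasDerivAt_id t).sub_const t0).const_mul (-(d * M0 / ℓ^2))
        exact e1.mul e2.exp
      have hft' : HasDerivAt (fun r => f r y) _ t :=
        ((H.dt t htI y hyI).sub (hbt.mul_const (φ y))).add
          ((((hasDerivAt_id t).sub_const t0).const_add 1).const_mul η)
      have htime := left_deriv_nonpos ht.1 hft' hft (by
        filter_upwards [Ioo_mem_nhdsLT ht.1] with r hr
        exact hnn r ⟨hr.1.le, hr.2.le⟩ y hy)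
      -- space
      let φ1 : ℝ → ℝ := fun y => -4 * ((y - x) / ℓ) * (1 - ((y - x) / ℓ) ^ 2) / ℓ
      have hφd : ∀ z, HasDerivAt φ (φ1 z) z := by
        intro z
        have e1 : HasDerivAt (fun z => (z - x) / ℓ) (1 / ℓ) z := by
          simpa using ((hasDerivAt_id z).sub_const x).div_const ℓ
        have e2 : HasDerivAt φ _ z := ((e1.pow 2).const_sub 1).pow 2
        refine e2.congr_deriv ?_
        simp only [φ1, Pi.pow_apply]; push_cast; ring
      have hφd2 : HasDerivAt φ1 ((12 * ((y - x) / ℓ) ^ 2 - 4) / ℓ ^ 2) y := by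
        have e1 : HasDerivAt (fun z => (z - x) / ℓ) (1 / ℓ) y := by
          simpa using ((hasDerivAt_id y).sub_const x).div_const ℓ
        have e2 : HasDerivAt φ1 _ y := ((e1.const_mul (-4)).mul ((e1.pow 2).const_sub 1)).div_const ℓ
        refine e2.congr_deriv ?_
        simp only [Pi.pow_apply]; push_cast; field_simp; ring
      have hmin : IsLocalMin (f t) y := by
        filter_upwards [Icc_mem_nhds hyo.1 hyo.2] with z hz
        rw [hft]; exact hnn t ⟨ht.1.le, le_rfl⟩ z hz
      obtain ⟨s1, s2⟩ := second_deriv_nonneg (φ := f t) (φ1 := fun z => deriv (w t) z - b t * φ1 z) hmin (by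
        filter_upwards [Ioo_mem_nhds hyI.1 hyI.2] with z hz
        exact ((H.d1 t htI z hz).sub ((hφd z).const_mul (b t))).add_const _)
        ((H.d2 t htI y hyI).sub (hφd2.const_mul (b t)))
      have halg := bump_alg (s := (y - x)/ℓ) H.hn hρ (hxa.trans hy.1) hN hℓ hℓ1 (hφ1 y hy)
      rw [← hM0] at halg
      have hbt0 := hb0 t ht.1.le
      have hSB' := hSB t ⟨ht.1.le, ht.2⟩ y hy
      have hbdef : b t = (A + B * (t - t0)) * Real.exp (-(d * M0 / ℓ^2) * (t - t0)) := rfl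
      have hE : Real.exp (-(d * M0 / ℓ^2) * (t - t0)) ≤ 1 := by
        apply Real.exp_le_one_iff.mpr
        have : 0 ≤ d * M0 / ℓ^2 := by positivity
        have := ht.1
        nlinarith
      have hE0 := Real.exp_pos (-(d * M0 / ℓ^2) * (t - t0))
      set E := Real.exp (-(d * M0 / ℓ^2) * (t - t0))
      have hφy := hφle y hy
      have hφdef : φ y = (1 - ((y - x) / ℓ) ^ 2) ^ 2 := rfl
      have hw1 : deriv (w t) y = b t * φ1 y := by simpa [sub_eq_zero] using s1
      rw [hw1] at htime
      have hφ1def : φ1 y = -4 * ((y - x) / ℓ) * (1 - ((y - x) / ℓ) ^ 2) / ℓ := rfl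
      rw [← hφ1def, ← hφdef] at halg
      have h3 : b t * (-(M0 / ℓ ^ 2) * φ y) ≤
        deriv (deriv (w t)) y + ((n:ℝ) - 1) / y * (b t * φ1 y) := by
        have := mul_le_mul_of_nonneg_left halg hbt0
        linarith
      have h4 := mul_le_mul_of_nonneg_left h3 hd.le
      have h5 : B * E * φ y ≤ B := by
        have : E * φ y ≤ 1 := mul_le_one₀ hE hφy.1 hφy.2
        have := mul_le_mul_of_nonneg_left this hB
        linarith
      have h6 : d * (b t * (-(M0 / ℓ ^ 2) * φ y)) = (A + B * (t - t0)) * (E * (-(d * M0 / ℓ^2))) * φ y := by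
        rw [hbdef]; ring
      linarith
  have h1 : Real.exp (-(d * M0)) ≤ Real.exp (-(d * M0 / ℓ^2) * s) := by
    apply Real.exp_le_exp.mpr
    have : d * M0 / ℓ^2 * s ≤ d * M0 := by
      rw [div_mul_eq_mul_div, div_le_iff₀ (by positivity)]
      have : 0 ≤ d * M0 := by positivity
      nlinarith
    linarith
  have hAB : 0 ≤ A + B * s := by positivity
  have h2 : Real.exp (-(d * M0)) * (A + B * s) ≤ (A + B * s) * Real.exp (-(d * M0 / ℓ^2) * s) := by nlinarith
  refine h2.trans ?_
  apply le_of_forall_pos_lt_add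
  intro ε hε
  have := key (ε / (1 + s)) (by positivity)
  have e : ε / (1 + s) * (1 + s) = ε := by field_simp
  linarith

structure Sys (n : ℕ) (R T p q d1 d2 α β : ℝ) (u v : ℝ → ℝ → ℝ) : Prop where
  hT : 0 < T
  hp : 1 < p
  hq : 1 < q
  hα : 0 < α
  hβ : 0 < β
  e1 : α * q = β + 1
  e2 : β * p = α + 1
  U : Rad n R T d1 u (fun t x => v t x ^ p)
  V : Rad n R T d2 v (fun t x => u t x ^ q)

lemma Sys.symm {n : ℕ} {R T p q d1 d2 α β : ℝ} {u v : ℝ → ℝ → ℝ}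
    (H : Sys n R T p q d1 d2 α β u v) : Sys n R T q p d2 d1 β α v u :=
  ⟨H.hT, H.hq, H.hp, H.hβ, H.hα, H.e2, H.e1, H.V, H.U⟩

lemma grow {n : ℕ} {R T p q d1 d2 α β ρa : ℝ} {u v : ℝ → ℝ → ℝ}
    (H : Sys n R T p q d1 d2 α β u v) (hρ : 0 < ρa) :
    ∃ c : ℝ, 0 < c ∧ c ≤ 1 ∧ ∀ x ℓ t0 s A : ℝ, 0 < ℓ → ℓ ≤ 1 → ρa ≤ x - 3 * ℓ → x ≤ R →
      0 ≤ t0 → 0 ≤ s → s ≤ ℓ ^ 2 → t0 + s < T → 0 ≤ A → A ≤ u t0 x →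
      c * A ≤ u (t0 + s) (x - ℓ) ∧ c * (s * (c * A) ^ q) ≤ v (t0 + s) (x - 2 * ℓ) := by
  obtain ⟨c1, h1, h1', k1⟩ := bump H.U hρ
  obtain ⟨c2, h2, h2', k2⟩ := bump H.V hρ
  refine ⟨min c1 c2, lt_min h1 h2, (min_le_left _ _).trans h1', ?_⟩
  intro x ℓ t0 s A hℓ hℓ1 hxa hxR ht0 hs hsℓ hsT hA hAu
  have hc1 : min c1 c2 ≤ c1 := min_le_left _ _
  have hc2 : min c1 c2 ≤ c2 := min_le_right _ _
  have hc0 : 0 < min c1 c2 := lt_min h1 h2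
  set c := min c1 c2
  have hu : ∀ r ∈ Icc 0 s, c * A ≤ u (t0 + r) (x - ℓ) := by
    intro r hr
    have := k1 (x - ℓ) ℓ t0 r A 0 hℓ hℓ1 (by linarith) (by linarith) ht0 hr.1 (hr.2.trans hsℓ)
      (by linarith [hr.2]) hA le_rfl (fun y hy => hAu.trans
        (H.U.mono t0 ⟨ht0, by linarith⟩ ⟨by linarith [hy.1], by linarith [hy.2]⟩ ⟨by linarith, hxR⟩ (by linarith [hy.2])))
        (fun t ht y hy => Real.rpow_nonneg (H.V.nn t ⟨by linarith [ht.1], by linarith [ht.2, hr.2]⟩ y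
          ⟨by linarith [hy.1], by linarith [hy.2]⟩) _)
    have h3 : c * A ≤ c1 * A := by gcongr
    linarith
  refine ⟨hu s ⟨hs, le_rfl⟩, ?_⟩
  have hcA : 0 ≤ c * A := by positivity
  have := k2 (x - 2 * ℓ) ℓ t0 s 0 ((c * A) ^ q) hℓ hℓ1 (by linarith) (by linarith) ht0 hs hsℓ hsT le_rfl
    (by positivity) (fun y hy => H.V.nn t0 ⟨ht0, by linarith⟩ y ⟨by linarith [hy.1], by linarith [hy.2]⟩)
    (fun t ht y hy => by
      have h4 := hu (t - t0) ⟨by linarith [ht.1], by linarith [ht.2]⟩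
      rw [add_sub_cancel] at h4
      have h5 := H.U.mono t ⟨by linarith [ht.1], by linarith [ht.2]⟩ (a := y) (b := x - ℓ) ⟨by linarith [hy.1], by linarith [hy.2]⟩
        ⟨by linarith, by linarith⟩ (by linarith [hy.2])
      exact Real.rpow_le_rpow hcA (h4.trans h5) (by linarith [H.hq]))
  have h6 : c * (s * (c * A) ^ q) ≤ c2 * (s * (c * A) ^ q) := by gcongr
  calc _ ≤ _ := h6
    _ ≤ _ := by convert this using 1; ring

lemma upper {n : ℕ} {R T p q d1 d2 α β b : ℝ} {u v : ℝ → ℝ → ℝ}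
    (H : Sys n R T p q d1 d2 α β u v) (hb : 0 < b) (hbR : b ≤ R) :
    ∃ C : ℝ, 0 < C ∧ ∀ t ∈ Ico 0 T, u t b ≤ (C / (T - t)) ^ α := by
  have hρ : 0 < b / 2 := by positivity
  obtain ⟨c1, h1, h1', k1⟩ := grow H hρ
  obtain ⟨c2, h2, h2', k2⟩ := grow H.symm hρ
  have hp := H.hp
  have hq := H.hq
  have hα := H.hα
  have hβ := H.hβ
  have hT := H.hT
  -- constant
  obtain ⟨D, hD⟩ : ∃ D, D = c2 * (c2 * (c1 * c1 ^ q)) ^ p := ⟨_, rfl⟩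
  have hDp : 0 < D := by rw [hD]; positivity
  obtain ⟨L, hL⟩ : ∃ L, L = max 1 ((4:ℝ) ^ α / D) := ⟨_, rfl⟩
  have hL1 : 1 ≤ L := by rw [hL]; exact le_max_left _ _
  have hL0 : 0 < L := by linarith
  have hLD : (4:ℝ) ^ α ≤ D * L ^ (p + 1) := by
    have a1 : (4:ℝ) ^ α / D ≤ L := by rw [hL]; exact le_max_right _ _
    have a2 : L ≤ L ^ (p + 1) := by
      calc L = L ^ (1:ℝ) := (Real.rpow_one L).symm
        _ ≤ _ := Real.rpow_le_rpow_of_exponent_le hL1 (by linarith)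
    rw [div_le_iff₀ hDp] at a1
    nlinarith
  -- algebra of one step
  have alg : ∀ σ > 0, (4 * L / σ) ^ α ≤ D * (σ * (σ * ((L / σ) ^ α) ^ q) ^ p) := by
    intro σ hσ
    have hLσ : 0 < L / σ := by positivity
    have a1 : (σ * (σ * ((L / σ) ^ α) ^ q) ^ p) = L ^ (p + 1) * (L / σ) ^ α := by
      rw [← Real.rpow_mul hLσ.le, H.e1]
      have : σ * (L / σ) ^ (β + 1) = L * (L / σ) ^ β := by
        rw [Real.rpow_add_one hLσ.ne']; field_simp
      rw [this, Real.mul_rpow hL0.le (by positivity), ← Real.rpow_mul hLσ.le, H.e2,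
        Real.rpow_add_one hLσ.ne', Real.rpow_add_one hL0.ne']
      field_simp
    rw [a1, mul_div_assoc, Real.mul_rpow (by norm_num) hLσ.le, ← mul_assoc]
    gcongr
  have main : ∀ t0 ς : ℝ, 0 ≤ t0 → 0 < ς → ς ≤ 1 → 8 * ς ≤ b / 2 → t0 + 3 * ς ^ 2 < T →
      u t0 b < (L / ς ^ 2) ^ α := by
    intro t0 ς ht0 hς hς1 hςb hςT
    by_contra! hcon
    have it : ∀ j : ℕ, ∃ t x, t0 ≤ t ∧ t ≤ t0 + 3 * ς ^ 2 - 3 * ς ^ 2 / 4 ^ j ∧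
        b - 8 * ς + 8 * ς / 2 ^ j ≤ x ∧ x ≤ b ∧ (L / (ς ^ 2 / 4 ^ j)) ^ α ≤ u t x := by
      intro j
      induction j with
      | zero => exact ⟨t0, b, le_rfl, by simp, by simp, le_rfl, by simpa using hcon⟩
      | succ j ih =>
        obtain ⟨t, x, i1, i2, i3, i4, i5⟩ := ih
        obtain ⟨ℓ, hℓ⟩ : ∃ ℓ, ℓ = ς / 2 ^ j := ⟨_, rfl⟩
        have hℓ0 : 0 < ℓ := by rw [hℓ]; positivity
        have hσ : ς ^ 2 / 4 ^ j = ℓ ^ 2 := by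
          rw [hℓ, div_pow, ← pow_mul, mul_comm j 2, pow_mul]; norm_num
        have hℓς : ℓ ≤ ς := by rw [hℓ]; exact div_le_self hς.le (one_le_pow₀ (by norm_num))
        have e1 : 8 * ς / 2 ^ j = 8 * ℓ := by rw [hℓ]; ring
        have e2 : 8 * ς / 2 ^ (j+1) = 4 * ℓ := by rw [hℓ, pow_succ]; field_simp; norm_num
        have e3 : 3 * ς ^ 2 / 4 ^ j = 3 * ℓ ^ 2 := by rw [mul_div_assoc, hσ]
        have e4 : ς ^ 2 / 4 ^ (j+1) = ℓ ^ 2 / 4 := by rw [← hσ, div_div, ← pow_succ]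
        have e5 : 3 * ς ^ 2 / 4 ^ (j+1) = 3 * (ℓ ^ 2 / 4) := by rw [mul_div_assoc, e4]
        rw [e3] at i2
        rw [e1] at i3
        rw [hσ] at i5
        have hℓ2 : 0 < ℓ ^ 2 := by positivity
        obtain ⟨-, g1⟩ := k1 x ℓ t (ℓ^2) ((L / ℓ^2) ^ α) hℓ0 (by linarith) (by linarith) (by linarith) (by linarith)
          hℓ2.le le_rfl (by linarith) (by positivity) i5
        obtain ⟨-, g2⟩ := k2 (x - 2 * ℓ) ℓ (t + ℓ^2) (ℓ^2) _ hℓ0 (by linarith) (by linarith) (by linarith) (by linarith)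
          hℓ2.le le_rfl (by linarith) (by positivity) g1
        refine ⟨t + ℓ^2 + ℓ^2, x - 2 * ℓ - 2 * ℓ, by linarith, ?_, ?_, by linarith, ?_⟩
        · rw [e5]; linarith
        · rw [e2]; linarith
        · rw [e4]
          have a2 := alg (ℓ^2) hℓ2
          have a3 : L / (ℓ ^ 2 / 4) = 4 * L / ℓ ^ 2 := by field_simp
          rw [a3]
          refine a2.trans (le_of_eq_of_le ?_ g2)
          rw [hD]
          have hX : 0 ≤ (L / ℓ ^ 2) ^ α := by positivity
          set X := (L / ℓ ^ 2) ^ α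
          rw [Real.mul_rpow h1.le hX]
          have : c2 * (c1 * (ℓ ^ 2 * (c1 ^ q * X ^ q))) = (c2 * (c1 * c1 ^ q)) * (ℓ^2 * X ^ q) := by ring
          rw [this, Real.mul_rpow (x := c2 * (c1 * c1 ^ q)) (y := ℓ^2 * X ^ q) (by positivity) (by positivity)]
          ring
    have hcomp : IsCompact (Icc 0 (t0 + 3 * ς^2) ×ˢ Icc 0 R) := isCompact_Icc.prod isCompact_Icc
    obtain ⟨B, hB⟩ := hcomp.bddAbove_image (f := Function.uncurry u) (H.U.cont.mono
      (prod_mono (fun r hr => ⟨hr.1, by linarith [hr.2]⟩) subset_rfl))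
    have htend : Tendsto (fun j : ℕ => (L / (ς ^ 2 / 4 ^ j)) ^ α) atTop atTop := by
      refine (tendsto_rpow_atTop hα).comp ?_
      have : (fun j : ℕ => L / (ς ^ 2 / 4 ^ j)) = fun j : ℕ => (L / ς ^ 2) * (4:ℝ) ^ j := by
        ext j; field_simp
      rw [this]
      exact (tendsto_pow_atTop_atTop_of_one_lt (by norm_num)).const_mul_atTop (by positivity)
    obtain ⟨j, hj⟩ := (htend.eventually_gt_atTop B).exists
    obtain ⟨t, x, i1, i2, i3, i4, i5⟩ := it j
    have i6 : 0 ≤ 3 * ς ^ 2 / 4 ^ j := by positivity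
    have i7 : 0 ≤ 8 * ς / 2 ^ j := by positivity
    have : u t x ≤ B := hB ⟨(t, x), ⟨⟨by linarith, by linarith⟩, ⟨by linarith, by linarith⟩⟩, rfl⟩
    linarith
  obtain ⟨e, he⟩ : ∃ e, e = min (1/4) (min 1 (b/16) ^ 2 / T) := ⟨_, rfl⟩
  have hmp : 0 < min 1 (b/16) := lt_min one_pos (by positivity)
  have he0 : 0 < e := by rw [he]; exact lt_min (by norm_num) (by positivity)
  have he1 : e ≤ 1/4 := by rw [he]; exact min_le_left _ _
  have he2 : e * T ≤ min 1 (b/16) ^ 2 := by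
    have : e ≤ min 1 (b/16) ^ 2 / T := by rw [he]; exact min_le_right _ _
    rwa [le_div_iff₀ hT] at this
  refine ⟨L / e, by positivity, ?_⟩
  intro t ht
  have hTt : 0 < T - t := by linarith [ht.2]
  have hσ : 0 < e * (T - t) := by positivity
  have hle : Real.sqrt (e * (T - t)) ≤ min 1 (b/16) := by
    rw [Real.sqrt_le_left hmp.le]
    have := ht.1
    nlinarith
  have := main t (Real.sqrt (e * (T - t))) ht.1 (Real.sqrt_pos.mpr hσ) (hle.trans (min_le_left _ _))
    (by linarith [hle.trans (min_le_right _ _)]) (by rw [Real.sq_sqrt hσ.le]; nlinarith)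
  rw [Real.sq_sqrt hσ.le, ← div_div] at this
  exact this.le

noncomputable def Yb (K ρ1 t0 T t ρ : ℝ) : ℝ := ρ - ρ1 + K * √(T - t) - (K - 1) * √(T - t0)

noncomputable def bar0 (A a η K ρ1 t0 T t ρ : ℝ) : ℝ :=
  A * (Yb K ρ1 t0 T t ρ) ^ (-2 * a) + η * (T - t0) ^ (-a) * (1 + (t - t0) / (T - t0))

noncomputable def bar1 (A a η K ρ1 t0 T t ρ : ℝ) : ℝ :=
  A * (max (Yb K ρ1 t0 T t ρ) (√(T - t))) ^ (-2 * a) + η * (T - t0) ^ (-a) * (1 + (t - t0) / (T - t0))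

lemma add_rpow_le2 {a b p : ℝ} (ha : 0 ≤ a) (hb : 0 ≤ b) (hp : 0 ≤ p) :
    (a + b) ^ p ≤ 2 ^ p * (a ^ p + b ^ p) := by
  have h1 : 0 ≤ a ^ p := by positivity
  have h2 : 0 ≤ b ^ p := by positivity
  have h3 : (0:ℝ) ≤ 2 ^ p := by positivity
  rcases le_total a b with h | h
  · calc (a + b) ^ p ≤ (2 * b) ^ p := by gcongr; linarith
      _ = 2 ^ p * b ^ p := Real.mul_rpow (by norm_num) hb
      _ ≤ _ := by gcongr; linarith
  · calc (a + b) ^ p ≤ (2 * a) ^ p := by gcongr; linarith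
      _ = 2 ^ p * a ^ p := Real.mul_rpow (by norm_num) ha
      _ ≤ _ := by gcongr; linarith

lemma barrier_touch {n : ℕ} {R T p q d1 d2 α β : ℝ} {u v : ℝ → ℝ → ℝ}
    (H : Sys n R T p q d1 d2 α β u v) {A A' η K ρ1 t0 t ρ : ℝ} (hA : 0 < A) (hA' : 0 < A')
    (hη : 0 < η) (hK : 0 < K)
    (c1 : 2 ^ p * A' ^ p ≤ α * A * (K - 2 * d1 * (2 * α + 1))) (c2 : 2 ^ p * (2 * η) ^ p < η)
    (ht0 : 0 ≤ t0) (htt : t0 < t) (htT : t < T) (hρ : ρ ∈ Ioo 0 R)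
    (hY : √(T - t) < Yb K ρ1 t0 T t ρ)
    (h0 : bar0 A α η K ρ1 t0 T t ρ = u t ρ)
    (hs : ∀ᶠ y in nhds ρ, u t y ≤ bar0 A α η K ρ1 t0 T t y)
    (ht : ∀ᶠ s in nhdsWithin t (Iio t), u s ρ ≤ bar0 A α η K ρ1 t0 T s ρ)
    (hv : v t ρ ≤ bar0 A' β η K ρ1 t0 T t ρ) : False := by
  have hp := H.hp
  have hα := H.hα
  have hβ := H.hβ
  have hd := H.U.hd
  have htI : t ∈ Ioo 0 T := ⟨by linarith, htT⟩
  have hTt : 0 < T - t := by linarith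
  have hTt0 : 0 < T - t0 := by linarith
  have hθ : 0 < √(T - t) := Real.sqrt_pos.mpr hTt
  have hY0 : 0 < Yb K ρ1 t0 T t ρ := hθ.trans hY
  have dY : ∀ y, HasDerivAt (fun y => Yb K ρ1 t0 T t y) 1 y := by
    intro y
    have : HasDerivAt (fun y => Yb K ρ1 t0 T t y) _ y :=
      (((hasDerivAt_id y).sub_const ρ1).add_const (K * √(T - t))).sub_const ((K - 1) * √(T - t0))
    exact this
  have dYt : HasDerivAt (fun s => Yb K ρ1 t0 T s ρ) (-(K / (2 * √(T - t)))) t := by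
    have e1 : HasDerivAt (fun s => √(T - s)) _ t := (((hasDerivAt_id t).const_sub T)).sqrt hTt.ne'
    have e2 : HasDerivAt (fun s => Yb K ρ1 t0 T s ρ) _ t :=
      ((e1.const_mul K).const_add (ρ - ρ1)).sub_const ((K - 1) * √(T - t0))
    refine e2.congr_deriv ?_
    simp only [id]; ring
  obtain ⟨Y, hYe⟩ : ∃ Y, Y = Yb K ρ1 t0 T t ρ := ⟨_, rfl⟩
  obtain ⟨θ, hθe⟩ : ∃ θ, θ = √(T - t) := ⟨_, rfl⟩
  -- time
  have dt : HasDerivAt (fun s => bar0 A α η K ρ1 t0 T s ρ - u s ρ) _ t :=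
    ((((dYt.rpow_const (p := -2 * α) (Or.inl hY0.ne')).const_mul A).add
      (((((hasDerivAt_id t).sub_const t0).div_const (T - t0)).const_add 1).const_mul (η * (T - t0) ^ (-α)))).sub
      (H.U.dt t htI ρ hρ))
  have htime := left_deriv_nonpos htt dt (by rw [h0]; ring) (by
    filter_upwards [ht] with s hs using by linarith)
  -- space
  have hYn : ∀ᶠ y in nhds ρ, 0 < Yb K ρ1 t0 T t y :=
    ((dY ρ).continuousAt.eventually (lt_mem_nhds hY0))
  obtain ⟨s1, s2⟩ := second_deriv_nonneg (φ := fun y => bar0 A α η K ρ1 t0 T t y - u t y)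
    (φ1 := fun y => A * (1 * (-2 * α) * (Yb K ρ1 t0 T t y) ^ (-2 * α - 1)) - deriv (u t) y) (x := ρ)
    (by
      filter_upwards [hs] with y hy
      simp only [h0]; linarith)
    (by
      filter_upwards [hYn, Ioo_mem_nhds hρ.1 hρ.2] with y hy hyI
      exact ((((dY y).rpow_const (p := -2 * α) (Or.inl hy.ne')).const_mul A).add_const _).sub (H.U.d1 t htI y hyI))
    ((((((dY ρ).rpow_const (p := -2 * α - 1) (Or.inl hY0.ne')).const_mul (1 * (-2 * α)))).const_mul A).sub (H.U.d2 t htI ρ hρ))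
  have hVp : v t ρ ^ p ≤ 2 ^ p * (A' ^ p * Y ^ (-2 * α - 2) + (2 * η) ^ p * (T - t0) ^ (-α - 1)) := by
    have hvn := H.V.nn t ⟨htI.1.le, htT⟩ ρ ⟨hρ.1.le, hρ.2.le⟩
    rw [bar0, ← hYe] at hv
    have hYp : 0 < Y := by rw [hYe]; exact hY0
    have b1 : η * (T - t0) ^ (-β) * (1 + (t - t0) / (T - t0)) ≤ (2 * η) * (T - t0) ^ (-β) := by
      have : (t - t0) / (T - t0) ≤ 1 := by rw [div_le_one hTt0]; linarith
      have h3 : 0 ≤ η * (T - t0) ^ (-β) := by positivity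
      nlinarith
    have b2 : v t ρ ≤ A' * Y ^ (-2 * β) + (2 * η) * (T - t0) ^ (-β) := by linarith
    calc v t ρ ^ p ≤ (A' * Y ^ (-2 * β) + (2 * η) * (T - t0) ^ (-β)) ^ p := by gcongr
      _ ≤ 2 ^ p * ((A' * Y ^ (-2 * β)) ^ p + ((2 * η) * (T - t0) ^ (-β)) ^ p) :=
        add_rpow_le2 (by positivity) (by positivity) (by linarith)
      _ = _ := by
        rw [Real.mul_rpow hA'.le (by positivity), Real.mul_rpow (x := 2 * η) (by positivity) (by positivity),
          ← Real.rpow_mul hYp.le, ← Real.rpow_mul hTt0.le]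
        have x1 : -2 * β * p = -2 * α - 2 := by linarith [H.e2]
        have x2 : -β * p = -α - 1 := by linarith [H.e2]
        rw [x1, x2]
  rw [← hYe] at htime s2 hY hY0
  simp only [← hYe] at s1
  rw [← hθe] at htime hY hθ
  have hw1 : deriv (u t) ρ = A * (1 * (-2 * α) * Y ^ (-2 * α - 1)) := by linarith
  have hn' : (0:ℝ) ≤ ((n:ℝ) - 1) / ρ := by
    have : (1:ℝ) ≤ n := by exact_mod_cast H.U.hn
    exact div_nonneg (by linarith) hρ.1.le
  have hdrift : ((n:ℝ) - 1) / ρ * deriv (u t) ρ ≤ 0 := by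
    apply mul_nonpos_of_nonneg_of_nonpos hn'
    rw [hw1]
    have : 0 < A * α * Y ^ (-2 * α - 1) := by positivity
    linarith
  have e3 : Y ^ (-2 * α - 1) = Y ^ (-2 * α - 2) * Y := by
    rw [← Real.rpow_add_one hY0.ne']; congr 1; ring
  have e4 : (T - t0) ^ (-α) = (T - t0) ^ (-α - 1) * (T - t0) := by
    rw [← Real.rpow_add_one hTt0.ne']; congr 1; ring
  have e5 : Y ^ (-2 * α - 1 - 1) = Y ^ (-2 * α - 2) := by congr 1; ring
  rw [e5] at s2
  rw [e3, e4] at htime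
  have hZ : 0 < Y ^ (-2 * α - 2) := by positivity
  have hX : 0 < (T - t0) ^ (-α - 1) := by positivity
  set Z := Y ^ (-2 * α - 2)
  set X := (T - t0) ^ (-α - 1)
  have e6 : η * (X * (T - t0)) * (1 / (T - t0)) = η * X := by field_simp
  rw [e6] at htime
  have e7 : α * A * K * Z ≤ A * (-(K / (2 * θ)) * (-2 * α) * (Z * Y)) := by
    have : A * (-(K / (2 * θ)) * (-2 * α) * (Z * Y)) = α * A * K * Z * (Y / θ) := by
      field_simp
    rw [this]
    have h1 : 1 ≤ Y / θ := by rw [one_le_div hθ]; exact hY.le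
    have h2 : 0 ≤ α * A * K * Z := by positivity
    nlinarith
  have e8 : d1 * (deriv (deriv (u t)) ρ + ((n:ℝ) - 1) / ρ * deriv (u t) ρ) ≤
     d1 * (2 * α * (2 * α + 1) * A * Z) := by
    gcongr
    linarith
  have e9 := mul_le_mul_of_nonneg_right c1 hZ.le
  have e10 := mul_lt_mul_of_pos_right c2 hX
  linarith

lemma bar_cont {A a η K ρ1 t0 T t1 R : ℝ} (h1 : t1 < T) :
    ContinuousOn (fun z : ℝ × ℝ => bar1 A a η K ρ1 t0 T z.1 z.2) (Icc t0 t1 ×ˢ Icc ρ1 R) := by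
  unfold bar1 Yb
  refine ContinuousOn.add (ContinuousOn.mul continuousOn_const (ContinuousOn.rpow_const (by fun_prop) ?_)) (by fun_prop)
  rintro ⟨t, ρ⟩ hz
  left
  have : 0 < √(T - t) := Real.sqrt_pos.mpr (by linarith [hz.1.2])
  exact (lt_max_of_lt_right this).ne'

lemma barrier {n : ℕ} {R T p q d1 d2 α β ρb C : ℝ} {u v : ℝ → ℝ → ℝ}
    (H : Sys n R T p q d1 d2 α β u v) (hb : 0 < ρb) (hC : 0 < C)
    (hu : ∀ t ∈ Ico 0 T, u t ρb ≤ (C / (T - t)) ^ α)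
    (hv : ∀ t ∈ Ico 0 T, v t ρb ≤ (C / (T - t)) ^ β) :
    ∃ η K : ℝ, 0 < η ∧ 0 < K ∧ ∀ ρ1 t0, ρb ≤ ρ1 → ρ1 < R → 0 ≤ t0 → t0 < T →
      u t0 ρ1 ≤ η * (T - t0) ^ (-α) → v t0 ρ1 ≤ η * (T - t0) ^ (-β) →
      ∀ ρ2, ρ1 + K * √(T - t0) ≤ ρ2 → ρ2 < R → ∃ M, ∀ t ∈ Ico t0 T, u t ρ2 + v t ρ2 ≤ M := by
  have hp := H.hp
  have hq := H.hq
  have hα := H.hα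
  have hβ := H.hβ
  have hd1 := H.U.hd
  have hd2 := H.V.hd
  have hCα : 0 < C ^ α := by positivity
  have hCβ : 0 < C ^ β := by positivity
  obtain ⟨K, hK1, hK2, hK3⟩ : ∃ K, 1 ≤ K ∧ 2 ^ p * (C ^ β) ^ p ≤ α * C ^ α * (K - 2 * d1 * (2 * α + 1)) ∧
      2 ^ q * (C ^ α) ^ q ≤ β * C ^ β * (K - 2 * d2 * (2 * β + 1)) := by
    refine ⟨max 1 (max (2 ^ p * (C ^ β) ^ p / (α * C ^ α) + 2 * d1 * (2 * α + 1))
      (2 ^ q * (C ^ α) ^ q / (β * C ^ β) + 2 * d2 * (2 * β + 1))), le_max_left _ _, ?_, ?_⟩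
    · rw [← div_le_iff₀' (by positivity), le_sub_iff_add_le]
      exact (le_max_left _ _).trans (le_max_right _ _)
    · rw [← div_le_iff₀' (by positivity), le_sub_iff_add_le]
      exact (le_max_right _ _).trans (le_max_right _ _)
  have hsmall : ∀ r : ℝ, 1 < r → ∀ᶠ η in nhdsWithin (0:ℝ) (Ioi 0), 2 ^ r * (2 * η) ^ r < η := by
    intro r hr
    have hc : Tendsto (fun η : ℝ => 2 ^ r * 2 ^ r * η ^ (r - 1)) (nhdsWithin (0:ℝ) (Ioi 0)) (nhds 0) := by
      have : ContinuousAt (fun η : ℝ => (2:ℝ) ^ r * 2 ^ r * η ^ (r - 1)) 0 :=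
        continuousAt_const.mul (Real.continuousAt_rpow_const 0 (r - 1) (Or.inr (by linarith)))
      have h2 := this.tendsto
      simp only [Real.zero_rpow (by linarith : r - 1 ≠ 0), mul_zero] at h2
      exact h2.mono_left nhdsWithin_le_nhds
    filter_upwards [hc.eventually (gt_mem_nhds one_pos), self_mem_nhdsWithin] with η h1 h2
    have h2' : 0 < η := h2
    rw [Real.mul_rpow (by norm_num) h2'.le]
    have : η ^ r = η ^ (r - 1) * η := by rw [← Real.rpow_add_one h2'.ne']; congr 1; ring
    rw [this]
    calc _ = (2 ^ r * 2 ^ r * η ^ (r - 1)) * η := by ring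
      _ < 1 * η := by gcongr
      _ = η := one_mul η
  obtain ⟨η, ⟨hη1, hη2⟩, hη0⟩ := (((hsmall p hp).and (hsmall q hq)).and self_mem_nhdsWithin).exists
  have hη : 0 < η := hη0
  refine ⟨η, K, hη, by linarith, ?_⟩
  intro ρ1 t0 hbρ hρR ht0 ht0T hu0 hv0 ρ2 hρ2 hρ2R
  have hTt0 : 0 < T - t0 := by linarith
  have hρ1 : 0 < ρ1 := by linarith
  -- general facts on bar1
  have fact1 : ∀ A a, 0 < A → ∀ t, t0 ≤ t → t < T → ∀ ρ,
      η * (T - t0) ^ (-a) < bar1 A a η K ρ1 t0 T t ρ := by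
    intro A a hA t h1 h2 ρ
    have : 0 < √(T - t) := Real.sqrt_pos.mpr (by linarith)
    have h3 : 0 < max (Yb K ρ1 t0 T t ρ) (√(T - t)) := lt_max_of_lt_right this
    have h4 : 0 < A * (max (Yb K ρ1 t0 T t ρ) (√(T - t))) ^ (-2 * a) := by positivity
    have h5 : 0 ≤ η * (T - t0) ^ (-a) * ((t - t0) / (T - t0)) := by
      have : 0 ≤ t - t0 := by linarith
      positivity
    unfold bar1; linarith
  have fact2 : ∀ a, 0 < a → ∀ t, t0 ≤ t → t < T → ∀ ρ, Yb K ρ1 t0 T t ρ ≤ √(T - t) →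
      (C / (T - t)) ^ a < bar1 (C ^ a) a η K ρ1 t0 T t ρ := by
    intro a ha t h1 h2 ρ h3
    have hTt : 0 < T - t := by linarith
    have h5 : 0 ≤ η * (T - t0) ^ (-a) * ((t - t0) / (T - t0)) := by
      have : 0 ≤ t - t0 := by linarith
      positivity
    have h6 : 0 < η * (T - t0) ^ (-a) := by positivity
    unfold bar1
    rw [max_eq_right h3, Real.sqrt_eq_rpow, ← Real.rpow_mul hTt.le, Real.div_rpow hC.le hTt.le]
    have : (1 / 2 : ℝ) * (-2 * a) = -a := by ring
    rw [this, Real.rpow_neg hTt.le, ← div_eq_mul_inv]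
    linarith
  have fact3 : ∀ A a t ρ, √(T - t) < Yb K ρ1 t0 T t ρ → bar1 A a η K ρ1 t0 T t ρ = bar0 A a η K ρ1 t0 T t ρ := by
    intro A a t ρ h
    unfold bar1 bar0; rw [max_eq_left h.le]
  have hYc : Continuous (fun z : ℝ × ℝ => Yb K ρ1 t0 T z.1 z.2 - √(T - z.1)) := by unfold Yb; fun_prop
  -- the comparison on [t0,t1]
  have main : ∀ t1, t0 ≤ t1 → t1 < T → ∀ t ∈ Icc t0 t1, ∀ ρ ∈ Icc ρ1 R,
      0 < min (bar1 (C^α) α η K ρ1 t0 T t ρ - u t ρ) (bar1 (C^β) β η K ρ1 t0 T t ρ - v t ρ) := by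
    intro t1 ht01 ht1T
    have hsub : Icc t0 t1 ×ˢ Icc ρ1 R ⊆ Ico 0 T ×ˢ Icc 0 R :=
      prod_mono (fun r hr => ⟨by linarith [hr.1], by linarith [hr.2]⟩) (fun r hr => ⟨by linarith [hr.1], hr.2⟩)
    apply first_touch isCompact_Icc
    · exact ContinuousOn.inf ((bar_cont ht1T).sub (H.U.cont.mono hsub)) ((bar_cont ht1T).sub (H.V.cont.mono hsub))
    · intro ρ hρ
      have m1 := H.U.mono t0 ⟨ht0, ht0T⟩ ⟨hρ1.le, hρR.le⟩ ⟨hρ1.le.trans hρ.1, hρ.2⟩ hρ.1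
      have m2 := H.V.mono t0 ⟨ht0, ht0T⟩ ⟨hρ1.le, hρR.le⟩ ⟨hρ1.le.trans hρ.1, hρ.2⟩ hρ.1
      have f1 := fact1 (C^α) α hCα t0 le_rfl ht0T ρ
      have f2 := fact1 (C^β) β hCβ t0 le_rfl ht0T ρ
      apply lt_min <;> linarith
    · intro t ht ρ hρ hmin hnn
      have htT : t < T := by linarith [ht.2]
      have htI : t ∈ Ico 0 T := ⟨by linarith [ht.1], htT⟩
      have htI' : t ∈ Ioo 0 T := ⟨by linarith [ht.1], htT⟩
      have htt := ht.1
      have hnn1 : ∀ s ∈ Icc t0 t, ∀ y ∈ Icc ρ1 R, u s y ≤ bar1 (C^α) α η K ρ1 t0 T s y := by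
        intro s hs y hy
        have := (hnn s hs y hy).trans (min_le_left _ _)
        linarith
      have hnn2 : ∀ s ∈ Icc t0 t, ∀ y ∈ Icc ρ1 R, v s y ≤ bar1 (C^β) β η K ρ1 t0 T s y := by
        intro s hs y hy
        have := (hnn s hs y hy).trans (min_le_right _ _)
        linarith
      have hor : bar1 (C^α) α η K ρ1 t0 T t ρ = u t ρ ∨ bar1 (C^β) β η K ρ1 t0 T t ρ = v t ρ := by
        rcases min_choice (bar1 (C^α) α η K ρ1 t0 T t ρ - u t ρ) (bar1 (C^β) β η K ρ1 t0 T t ρ - v t ρ) with h | h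
        · left; linarith
        · right; linarith
      have up1 : u t ρ ≤ (C / (T - t)) ^ α := (H.U.mono t htI ⟨hb.le, by linarith⟩ ⟨hρ1.le.trans hρ.1, hρ.2⟩
        (hbρ.trans hρ.1)).trans (hu t htI)
      have up2 : v t ρ ≤ (C / (T - t)) ^ β := (H.V.mono t htI ⟨hb.le, by linarith⟩ ⟨hρ1.le.trans hρ.1, hρ.2⟩
        (hbρ.trans hρ.1)).trans (hv t htI)
      have hY : √(T - t) < Yb K ρ1 t0 T t ρ := by
        by_contra! hle
        have f1 := fact2 α hα t htt.le htT ρ hle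
        have f2 := fact2 β hβ t htt.le htT ρ hle
        rcases hor with h | h <;> linarith
      have hρl : ρ1 < ρ := by
        unfold Yb at hY
        have : √(T - t) ≤ √(T - t0) := Real.sqrt_le_sqrt (by linarith)
        nlinarith
      have hρr : ρ < R := by
        refine lt_of_le_of_ne hρ.2 ?_
        rintro rfl
        have f1 := fact1 (C^α) α hCα t htt.le htT ρ
        have f2 := fact1 (C^β) β hCβ t htt.le htT ρ
        have g1 : 0 < η * (T - t0) ^ (-α) := by positivity
        have g2 : 0 < η * (T - t0) ^ (-β) := by positivity
        have b1 := H.U.bc t htI'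
        have b2 := H.V.bc t htI'
        rcases hor with h | h <;> linarith
      have hρI : ρ ∈ Ioo 0 R := ⟨by linarith, hρr⟩
      -- neighborhoods
      have nb1 : ∀ᶠ y in nhds ρ, √(T - t) < Yb K ρ1 t0 T t y := by
        have hc : Continuous (fun y : ℝ => Yb K ρ1 t0 T t y - √(T - t)) := by unfold Yb; fun_prop
        have := hc.continuousAt.eventually (lt_mem_nhds (show (0:ℝ) < Yb K ρ1 t0 T t ρ - √(T - t) by linarith))
        filter_upwards [this] with y hy using by linarith
      have nb2 : ∀ᶠ s in nhdsWithin t (Iio t), √(T - s) < Yb K ρ1 t0 T s ρ := by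
        have hc : Continuous (fun y : ℝ => Yb K ρ1 t0 T y ρ - √(T - y)) := by unfold Yb; fun_prop
        have := hc.continuousAt.eventually (lt_mem_nhds (show (0:ℝ) < Yb K ρ1 t0 T t ρ - √(T - t) by linarith))
        filter_upwards [this.filter_mono nhdsWithin_le_nhds] with y hy using by linarith
      have nb3 : ∀ᶠ y in nhds ρ, y ∈ Icc ρ1 R := Icc_mem_nhds hρl hρr
      have nb4 : ∀ᶠ s in nhdsWithin t (Iio t), s ∈ Icc t0 t := by
        filter_upwards [Ioo_mem_nhdsLT htt] with r hr using ⟨hr.1.le, hr.2.le⟩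
      have tm : t ∈ Icc t0 t := ⟨htt.le, le_rfl⟩
      rcases hor with h | h
      · refine barrier_touch H hCα hCβ hη (by linarith) hK2 hη1 ht0 htt htT hρI hY (by rw [← fact3 _ _ _ _ hY]; exact h) ?_ ?_ ?_
        · filter_upwards [nb1, nb3] with y y1 y2
          rw [← fact3 _ _ _ _ y1]; exact hnn1 t tm y y2
        · filter_upwards [nb2, nb4] with s y1 y2
          rw [← fact3 _ _ _ _ y1]; exact hnn1 s y2 ρ hρ
        · rw [← fact3 _ _ _ _ hY]; exact hnn2 t tm ρ hρ
      · refine barrier_touch H.symm hCβ hCα hη (by linarith) hK3 hη2 ht0 htt htT hρI hY (by rw [← fact3 _ _ _ _ hY]; exact h) ?_ ?_ ?_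
        · filter_upwards [nb1, nb3] with y y1 y2
          rw [← fact3 _ _ _ _ y1]; exact hnn2 t tm y y2
        · filter_upwards [nb2, nb4] with s y1 y2
          rw [← fact3 _ _ _ _ y1]; exact hnn2 s y2 ρ hρ
        · rw [← fact3 _ _ _ _ hY]; exact hnn1 t tm ρ hρ
  have hθ0 : 0 < √(T - t0) := Real.sqrt_pos.mpr hTt0
  have hbound : ∀ A a, 0 < A → 0 < a → ∀ t, t0 ≤ t → t < T →
      bar1 A a η K ρ1 t0 T t ρ2 ≤ A * (√(T - t0)) ^ (-2 * a) + η * (T - t0) ^ (-a) * 2 := by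
    intro A a hA ha t h1 h2
    have hY : √(T - t0) ≤ Yb K ρ1 t0 T t ρ2 := by
      unfold Yb
      have : 0 ≤ K * √(T - t) := by positivity
      linarith
    unfold bar1
    have h3 : (t - t0) / (T - t0) ≤ 1 := by rw [div_le_one hTt0]; linarith
    have h4 : (max (Yb K ρ1 t0 T t ρ2) (√(T - t))) ^ (-2 * a) ≤ (√(T - t0)) ^ (-2 * a) :=
      Real.rpow_le_rpow_of_nonpos hθ0 (hY.trans (le_max_left _ _)) (by linarith)
    have h5 : 0 < η * (T - t0) ^ (-a) := by positivity
    have h6 : 1 + (t - t0) / (T - t0) ≤ 2 := by linarith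
    gcongr
  refine ⟨(C^α * (√(T - t0)) ^ (-2 * α) + η * (T - t0) ^ (-α) * 2) +
    (C^β * (√(T - t0)) ^ (-2 * β) + η * (T - t0) ^ (-β) * 2), ?_⟩
  intro t ht
  have hm := main t ht.1 ht.2 t ⟨ht.1, le_rfl⟩ ρ2 ⟨by nlinarith, hρ2R.le⟩
  have m1 := lt_of_lt_of_le hm (min_le_left _ _)
  have m2 := lt_of_lt_of_le hm (min_le_right _ _)
  have b1 := hbound (C^α) α hCα hα t ht.1 ht.2
  have b2 := hbound (C^β) β hCβ hβ t ht.1 ht.2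
  linarith

lemma half_lower {n : ℕ} {R T p q d1 d2 α β ρ1 η : ℝ} {u v : ℝ → ℝ → ℝ}
    (H : Sys n R T p q d1 d2 α β u v) (hρ1 : 0 < ρ1) (hη : 0 < η) :
    ∃ k > 0, ∀ ρ' t s, ρ' ≤ R → 0 < s → t + s = T → 0 ≤ t - s → √s ≤ 1 → ρ1 + 3 * √s ≤ ρ' →
      η * (2 * s) ^ (-α) ≤ u (t - s) ρ' → k * s ^ (-α) ≤ u t ρ1 ∧ k * s ^ (-β) ≤ v t ρ1 := by
  have hq := H.hq
  obtain ⟨c, hc, hc1, k⟩ := grow H hρ1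
  obtain ⟨k1, hk1⟩ : ∃ k1, k1 = c * (η * 2 ^ (-α)) := ⟨_, rfl⟩
  have hk1p : 0 < k1 := by rw [hk1]; positivity
  refine ⟨min k1 (c * k1 ^ q), by positivity, ?_⟩
  intro ρ' t s hρR hs hts hts0 hs1 hρ' hA
  have hl : 0 < √s := Real.sqrt_pos.mpr hs
  obtain ⟨g1, g2⟩ := k ρ' (√s) (t - s) s (η * (2 * s) ^ (-α)) hl hs1 (by linarith) hρR hts0 hs.le
    (by rw [Real.sq_sqrt hs.le]) (by linarith) (by positivity) hA
  rw [sub_add_cancel] at g1 g2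
  have hI : t ∈ Ico 0 T := ⟨by linarith, by linarith⟩
  have m1 := H.U.mono t hI (a := ρ1) (b := ρ' - √s) ⟨hρ1.le, by linarith⟩ ⟨by linarith, by linarith⟩ (by linarith)
  have m2 := H.V.mono t hI (a := ρ1) (b := ρ' - 2 * √s) ⟨hρ1.le, by linarith⟩ ⟨by linarith, by linarith⟩ (by linarith)
  have e1 : c * (η * (2 * s) ^ (-α)) = k1 * s ^ (-α) := by
    rw [hk1, Real.mul_rpow (by norm_num) hs.le]; ring
  have e2 : s * (k1 * s ^ (-α)) ^ q = k1 ^ q * s ^ (-β) := by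
    rw [Real.mul_rpow hk1p.le (by positivity), ← Real.rpow_mul hs.le]
    have : -α * q = -β - 1 := by linarith [H.e1]
    rw [this, Real.rpow_sub_one hs.ne']; field_simp
  rw [e1] at g1 g2
  rw [e2] at g2
  have p1 : 0 < s ^ (-α) := by positivity
  have p2 : 0 < s ^ (-β) := by positivity
  constructor
  · calc _ ≤ k1 * s ^ (-α) := by gcongr; exact min_le_left _ _
      _ ≤ _ := by linarith
  · calc _ ≤ (c * k1 ^ q) * s ^ (-β) := by gcongr; exact min_le_right _ _
      _ ≤ _ := by linarith

lemma lower {n : ℕ} {R T p q d1 d2 α β ρ1 ρ0 : ℝ} {u v : ℝ → ℝ → ℝ}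
    (H : Sys n R T p q d1 d2 α β u v) (hρ1 : 0 < ρ1) (h10 : ρ1 < ρ0) (h0R : ρ0 < R)
    (hunb : ∀ M, ∃ t ∈ Ioo 0 T, M < u t ρ0 + v t ρ0) :
    ∃ ts c, 0 < ts ∧ ts < T ∧ 0 < c ∧ ∀ t ∈ Ico ts T, (c / (T - t)) ^ α ≤ u t ρ1 ∧ (c / (T - t)) ^ β ≤ v t ρ1 := by
  have hT := H.hT
  have hα := H.hα
  have hβ := H.hβ
  have hb : 0 < ρ1 / 2 := by positivity
  obtain ⟨C1, hC1, u1⟩ := upper H hb (by linarith)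
  obtain ⟨C2, hC2, u2⟩ := upper H.symm hb (by linarith)
  have hC : 0 < max C1 C2 := lt_max_of_lt_left hC1
  obtain ⟨η, K, hη, hK, bar⟩ := barrier H hb hC
    (fun t ht => (u1 t ht).trans (by
      have : 0 < T - t := by linarith [ht.2]
      gcongr; exact le_max_left _ _))
    (fun t ht => (u2 t ht).trans (by
      have : 0 < T - t := by linarith [ht.2]
      gcongr; exact le_max_right _ _))
  obtain ⟨k1, hk1, a1⟩ := half_lower H hρ1 hη
  obtain ⟨k2, hk2, a2⟩ := half_lower H.symm hρ1 hη
  obtain ⟨g, hg⟩ : ∃ g, g = (ρ0 - ρ1) / 2 := ⟨_, rfl⟩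
  have hg0 : 0 < g := by rw [hg]; linarith
  obtain ⟨m, hm⟩ : ∃ m, m = min (g / (K + 3)) 1 := ⟨_, rfl⟩
  have hm0 : 0 < m := by rw [hm]; positivity
  have hm1 : m ≤ 1 := by rw [hm]; exact min_le_right _ _
  have hmg : K * m + 3 * m ≤ g := by
    have : m ≤ g / (K + 3) := by rw [hm]; exact min_le_left _ _
    rw [le_div_iff₀ (by positivity)] at this
    linarith
  have hmm : 0 < min (m ^ 2) T := lt_min (by positivity) hT
  have hmm1 : min (m ^ 2) T ≤ m ^ 2 := min_le_left _ _
  have hmm2 : min (m ^ 2) T ≤ T := min_le_right _ _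
  obtain ⟨k, hk⟩ : ∃ k, k = min k1 k2 := ⟨_, rfl⟩
  have hk0 : 0 < k := by rw [hk]; exact lt_min hk1 hk2
  have hkk1 : k ≤ k1 := by rw [hk]; exact min_le_left _ _
  have hkk2 : k ≤ k2 := by rw [hk]; exact min_le_right _ _
  have conv : ∀ a s : ℝ, 0 < a → 0 < s → min (k ^ (1/α)) (k ^ (1/β)) ≤ k ^ (1/a) →
      (min (k ^ (1/α)) (k ^ (1/β)) / s) ^ a ≤ k * s ^ (-a) := by
    intro a s ha hs h
    have h0 : 0 < min (k ^ (1/α)) (k ^ (1/β)) := by positivity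
    calc _ ≤ (k ^ (1/a) / s) ^ a := by gcongr
      _ = _ := by
        rw [Real.div_rpow (by positivity) hs.le, ← Real.rpow_mul hk0.le, one_div_mul_cancel ha.ne',
          Real.rpow_one, Real.rpow_neg hs.le]; rfl
  refine ⟨T - min (m ^ 2) T / 2, min (k ^ (1/α)) (k ^ (1/β)), by linarith, by linarith, by positivity, ?_⟩
  intro t ht
  obtain ⟨s, hs⟩ : ∃ s, s = T - t := ⟨_, rfl⟩
  rw [← hs]
  have hs0 : 0 < s := by linarith [ht.2]
  have hs2 : 2 * s ≤ m ^ 2 := by linarith [ht.1]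
  have hsT : 2 * s ≤ T := by linarith [ht.1]
  have r2 : √(2 * s) ≤ m := by rw [Real.sqrt_le_left hm0.le]; exact hs2
  have r1 : √s ≤ m := (Real.sqrt_le_sqrt (by linarith)).trans r2
  have ht0 : T - (t - s) = 2 * s := by linarith
  have key : η * (2 * s) ^ (-α) ≤ u (t - s) (ρ1 + g) ∨ η * (2 * s) ^ (-β) ≤ v (t - s) (ρ1 + g) := by
    by_contra! hcon
    obtain ⟨M, hM⟩ := bar (ρ1 + g) (t - s) (by linarith) (by linarith) (by linarith) (by linarith)
      (by rw [ht0]; exact hcon.1.le) (by rw [ht0]; exact hcon.2.le) ρ0 (by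
        rw [ht0]
        have : K * √(2 * s) ≤ K * m := by gcongr
        linarith) h0R
    have hρ0 : ρ0 ∈ Icc 0 R := ⟨by linarith, h0R.le⟩
    have hcont : ContinuousOn (fun r => u r ρ0 + v r ρ0) (Icc 0 (t - s)) := by
      have hp : ContinuousOn (fun r : ℝ => (r, ρ0)) (Icc 0 (t - s)) := by fun_prop
      have hmap : MapsTo (fun r : ℝ => (r, ρ0)) (Icc 0 (t - s)) (Ico 0 T ×ˢ Icc 0 R) :=
        fun r hr => ⟨⟨hr.1, by linarith [hr.2]⟩, hρ0⟩
      exact (H.U.cont.comp hp hmap).add (H.V.cont.comp hp hmap)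
    obtain ⟨M', hM'⟩ := isCompact_Icc.bddAbove_image hcont
    obtain ⟨r, hr, hr2⟩ := hunb (max M M')
    rcases le_total r (t - s) with h | h
    · have := hM' (mem_image_of_mem _ ⟨hr.1.le, h⟩)
      linarith [le_max_right M M']
    · have := hM r ⟨h, hr.2⟩
      linarith [le_max_left M M']
  have q1 : 0 < s ^ (-α) := by positivity
  have q2 : 0 < s ^ (-β) := by positivity
  have w1 := mul_le_mul_of_nonneg_right hkk1 q1.le
  have w2 := mul_le_mul_of_nonneg_right hkk1 q2.le
  have w3 := mul_le_mul_of_nonneg_right hkk2 q1.le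
  have w4 := mul_le_mul_of_nonneg_right hkk2 q2.le
  have z1 := conv α s hα hs0 (min_le_left _ _)
  have z2 := conv β s hβ hs0 (min_le_right _ _)
  have hKm : 0 < K * m := by positivity
  rcases key with h | h
  · obtain ⟨b1, b2⟩ := a1 (ρ1 + g) t s (by linarith) hs0 (by linarith) (by linarith) (by linarith) (by linarith) h
    constructor <;> linarith
  · obtain ⟨b1, b2⟩ := a2 (ρ1 + g) t s (by linarith) hs0 (by linarith) (by linarith) (by linarith) (by linarith) h
    constructor <;> linarith

noncomputable def bb (ε ξ r x y : ℝ) : ℝ :=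
  ε * (max (r ^ 2 - ((x + y) / 2 - ξ) ^ 2) 0) ^ 2 * max ((y - x) * (r - (y - x))) 0

lemma bb_nonneg {ε ξ r x y : ℝ} (hε : 0 ≤ ε) : 0 ≤ bb ε ξ r x y := by
  unfold bb; positivity

lemma bb_cont : Continuous (fun z : (ℝ × ℝ) × (ℝ × ℝ) × ℝ => bb z.1.1 z.1.2 z.2.2 z.2.1.1 z.2.1.2) := by
  unfold bb; fun_prop

/-- positive bump means inside the support -/
lemma bb_supp {ε ξ r x y : ℝ} (hr : 0 < r) (h : bb ε ξ r x y ≠ 0) :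
    0 < r ^ 2 - ((x + y) / 2 - ξ) ^ 2 ∧ 0 < (y - x) * (r - (y - x)) ∧ |(x + y) / 2 - ξ| < r ∧
    x < y ∧ y - x < r := by
  unfold bb at h
  have h1 : 0 < r ^ 2 - ((x + y) / 2 - ξ) ^ 2 := by
    by_contra! hc
    apply h; rw [max_eq_right hc]; ring
  have h2 : 0 < (y - x) * (r - (y - x)) := by
    by_contra! hc
    apply h; rw [max_eq_right hc]; ring
  refine ⟨h1, h2, abs_lt_of_sq_lt_sq (by linarith) hr.le, ?_, ?_⟩
  · by_contra! hc
    nlinarith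
  · by_contra! hc
    nlinarith

lemma bb_eq {ε ξ r x y : ℝ} (h1 : 0 ≤ r ^ 2 - ((x + y) / 2 - ξ) ^ 2) (h2 : 0 ≤ (y - x) * (r - (y - x))) :
    bb ε ξ r x y = ε * (r ^ 2 - ((x + y) / 2 - ξ) ^ 2) ^ 2 * ((y - x) * (r - (y - x))) := by
  unfold bb; rw [max_eq_left h1, max_eq_left h2]

lemma two_point {A B A1 B1 : ℝ → ℝ} {A2 B2 x y ε ξ r c : ℝ}
    (hA : ∀ᶠ s in nhds x, HasDerivAt A (A1 s) s) (hA2 : HasDerivAt A1 A2 x)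
    (hB : ∀ᶠ s in nhds y, HasDerivAt B (B1 s) s) (hB2 : HasDerivAt B1 B2 y)
    (hω : 0 < r ^ 2 - ((x + y) / 2 - ξ) ^ 2) (hχ : 0 < (y - x) * (r - (y - x)))
    (h0 : A x + B y - bb ε ξ r x y + c = 0)
    (hm : ∀ᶠ z : ℝ × ℝ in nhds (x, y), 0 ≤ A z.1 + B z.2 - bb ε ξ r z.1 z.2 + c) :
    A1 x = -2 * ε * (r ^ 2 - ((x + y) / 2 - ξ) ^ 2) * ((x + y) / 2 - ξ) * ((y - x) * (r - (y - x)))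
      - ε * (r ^ 2 - ((x + y) / 2 - ξ) ^ 2) ^ 2 * (r - 2 * (y - x)) ∧
    B1 y = -2 * ε * (r ^ 2 - ((x + y) / 2 - ξ) ^ 2) * ((x + y) / 2 - ξ) * ((y - x) * (r - (y - x)))
      + ε * (r ^ 2 - ((x + y) / 2 - ξ) ^ 2) ^ 2 * (r - 2 * (y - x)) ∧
    ε * (8 * ((x + y) / 2 - ξ) ^ 2 - 4 * (r ^ 2 - ((x + y) / 2 - ξ) ^ 2)) * ((y - x) * (r - (y - x))) ≤ A2 + B2 := by
  rw [bb_eq hω.le hχ.le] at h0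
  have hm' : ∀ᶠ z : ℝ × ℝ in nhds (x, y), 0 ≤ A z.1 + B z.2 -
      ε * (r ^ 2 - ((z.1 + z.2) / 2 - ξ) ^ 2) ^ 2 * ((z.2 - z.1) * (r - (z.2 - z.1))) + c := by
    have c1 : Continuous (fun z : ℝ × ℝ => r ^ 2 - ((z.1 + z.2) / 2 - ξ) ^ 2) := by fun_prop
    have c2 : Continuous (fun z : ℝ × ℝ => (z.2 - z.1) * (r - (z.2 - z.1))) := by fun_prop
    filter_upwards [hm, c1.continuousAt.eventually (lt_mem_nhds (a := 0) (b := r ^ 2 - ((x + y) / 2 - ξ) ^ 2) hω),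
      c2.continuousAt.eventually (lt_mem_nhds (a := 0) (b := (y - x) * (r - (y - x))) hχ)] with z h1 h2 h3
    rwa [bb_eq h2.le h3.le] at h1
  have hx : ∀ᶠ s in nhds x, 0 ≤ A s + B y -
      ε * (r ^ 2 - ((s + y) / 2 - ξ) ^ 2) ^ 2 * ((y - s) * (r - (y - s))) + c :=
    (Continuous.tendsto' (by fun_prop : Continuous fun s : ℝ => (s, y)) x (x, y) rfl).eventually hm'
  have hy : ∀ᶠ s in nhds y, 0 ≤ A x + B s -
      ε * (r ^ 2 - ((x + s) / 2 - ξ) ^ 2) ^ 2 * ((s - x) * (r - (s - x))) + c :=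
    (Continuous.tendsto' (by fun_prop : Continuous fun s : ℝ => (x, s)) y (x, y) rfl).eventually hm'
  have hd : ∀ᶠ s in nhds (0:ℝ), 0 ≤ A (x + s) + B (y + s) -
      ε * (r ^ 2 - (((x + s) + (y + s)) / 2 - ξ) ^ 2) ^ 2 * (((y + s) - (x + s)) * (r - ((y + s) - (x + s)))) + c :=
    (Continuous.tendsto' (by fun_prop : Continuous fun s : ℝ => (x + s, y + s)) 0 (x, y) (by simp)).eventually hm'
  refine ⟨?_, ?_, ?_⟩
  · have hmin : IsLocalMin (fun s => A s + B y -
      ε * (r ^ 2 - ((s + y) / 2 - ξ) ^ 2) ^ 2 * ((y - s) * (r - (y - s))) + c) x := by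
      filter_upwards [hx] with s hs
      rw [h0]; exact hs
    have hi := hasDerivAt_id x
    have e1 : HasDerivAt (fun s => r ^ 2 - ((s + y) / 2 - ξ) ^ 2) _ x :=
      ((((hi.add_const y).div_const 2).sub_const ξ).pow 2).const_sub (r ^ 2)
    have e2 : HasDerivAt (fun s => (y - s) * (r - (y - s))) _ x :=
      (hi.const_sub y).mul ((hi.const_sub y).const_sub r)
    have e3 := hmin.hasDerivAt_eq_zero
      (((hA.self_of_nhds.add_const (B y)).sub (((e1.pow 2).const_mul ε).mul e2)).add_const c)
    simp only [id] at e3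
    norm_num at e3
    linear_combination e3
  · have hmin : IsLocalMin (fun s => A x + B s -
      ε * (r ^ 2 - ((x + s) / 2 - ξ) ^ 2) ^ 2 * ((s - x) * (r - (s - x))) + c) y := by
      filter_upwards [hy] with s hs
      rw [h0]; exact hs
    have hi := hasDerivAt_id y
    have e1 : HasDerivAt (fun s => r ^ 2 - ((x + s) / 2 - ξ) ^ 2) _ y :=
      ((((hi.const_add x).div_const 2).sub_const ξ).pow 2).const_sub (r ^ 2)
    have e2 : HasDerivAt (fun s => (s - x) * (r - (s - x))) _ y :=
      (hi.sub_const x).mul ((hi.sub_const x).const_sub r)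
    have e3 := hmin.hasDerivAt_eq_zero
      (((hB.self_of_nhds.const_add (A x)).sub (((e1.pow 2).const_mul ε).mul e2)).add_const c)
    simp only [id] at e3
    norm_num at e3
    linear_combination e3
  · obtain ⟨χ, hχe⟩ : ∃ χ, χ = (y - x) * (r - (y - x)) := ⟨_, rfl⟩
    rw [← hχe] at h0 ⊢
    have hmin : IsLocalMin (fun s => A (x + s) + B (y + s) -
      ε * (r ^ 2 - ((x + y) / 2 - ξ + s) ^ 2) ^ 2 * χ + c) 0 := by
      filter_upwards [hd] with s hs
      simp only [add_zero]
      rw [h0]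
      refine hs.trans_eq ?_
      rw [hχe]; ring
    have e1 : ∀ s : ℝ, HasDerivAt (fun s => r ^ 2 - ((x + y) / 2 - ξ + s) ^ 2) (-(2 * ((x + y) / 2 - ξ + s))) s := by
      intro s
      have : HasDerivAt (fun s => r ^ 2 - ((x + y) / 2 - ξ + s) ^ 2) _ s :=
        (((hasDerivAt_id s).const_add ((x + y) / 2 - ξ)).pow 2).const_sub (r ^ 2)
      refine this.congr_deriv ?_
      simp only [id]; ring
    have tx : ∀ᶠ s in nhds (0:ℝ), HasDerivAt A (A1 (x + s)) (x + s) :=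
      (Continuous.tendsto' (by fun_prop : Continuous fun s : ℝ => x + s) 0 x (by simp)).eventually hA
    have ty : ∀ᶠ s in nhds (0:ℝ), HasDerivAt B (B1 (y + s)) (y + s) :=
      (Continuous.tendsto' (by fun_prop : Continuous fun s : ℝ => y + s) 0 y (by simp)).eventually hB
    have hA2' : HasDerivAt A1 A2 (x + 0) := by simpa using hA2
    have hB2' : HasDerivAt B1 B2 (y + 0) := by simpa using hB2
    obtain ⟨_, s2⟩ := second_deriv_nonneg hmin
      (φ1 := fun s => A1 (x + s) + B1 (y + s) +
        4 * ε * χ * ((r ^ 2 - ((x + y) / 2 - ξ + s) ^ 2) * ((x + y) / 2 - ξ + s)))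
      (φ2 := A2 + B2 + 4 * ε * χ * (-(2 * ((x + y) / 2 - ξ + 0)) * ((x + y) / 2 - ξ + 0) + (r ^ 2 - ((x + y) / 2 - ξ + 0) ^ 2) * 1))
      (by
        filter_upwards [tx, ty] with s h1 h2
        have := ((((h1.comp_const_add x s).add (h2.comp_const_add y s)).sub
          ((((e1 s).pow 2).const_mul ε).mul_const χ)).add_const c)
        refine this.congr_deriv ?_
        norm_num; ring)
      (((hA2'.comp_const_add x 0).add (hB2'.comp_const_add y 0)).add
        (((e1 0).mul ((hasDerivAt_id (0:ℝ)).const_add ((x + y) / 2 - ξ))).const_mul (4 * ε * χ)))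
    linear_combination s2

lemma spatial_alg {A1 B1 L x y ε μ ω χ z r N ρa d σ E : ℝ} (hε : 0 < ε) (hρ : 0 < ρa) (hr : 0 < r) (hN : 0 ≤ N)
    (hd : 0 < d) (hσ : 0 ≤ σ)
    (hx : ρa ≤ x) (hz : z = y - x) (hz0 : 0 < z) (hχe : χ = z * (r - z)) (hχ : 0 < χ)
    (hωe : ω = r ^ 2 - μ ^ 2) (hω : 0 < ω) (hμ : |μ| ≤ r)
    (hA : A1 = -2 * ε * ω * μ * χ - ε * ω ^ 2 * (r - 2 * z))
    (hB : B1 = -2 * ε * ω * μ * χ + ε * ω ^ 2 * (r - 2 * z))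
    (hL : ε * (8 * μ ^ 2 - 4 * ω) * χ ≤ L)
    (hE : E = 4 * r * σ + d * (12 + 4 * N * r / ρa)) :
    0 ≤ d * (L + N / x * A1 + N / y * B1) - 4 * r * σ * ε * ω * χ
      + (d * N / ρa ^ 2 + E ^ 2 / (32 * d * r ^ 2)) * (ε * ω ^ 2 * χ) := by
  have hx0 : 0 < x := by linarith
  have hy0 : 0 < y := by linarith
  have hy : ρa ≤ y := by linarith
  have hP : 0 < ε * ω * χ := by positivity
  -- sum term
  have s1 : N / x + N / y ≤ 2 * N / ρa := by
    have h1 : N / x ≤ N / ρa := by gcongr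
    have h2 : N / y ≤ N / ρa := by gcongr
    have : 2 * N / ρa = N / ρa + N / ρa := by ring
    linarith
  have s2 : 0 ≤ N / x + N / y := by positivity
  have s3 : -(4 * N * r / ρa) * (ε * ω * χ) ≤ (N / x + N / y) * (-2 * ε * ω * μ * χ) := by
    have h1 : (N / x + N / y) * μ ≤ 2 * N / ρa * r := by
      calc (N / x + N / y) * μ ≤ (N / x + N / y) * r := by gcongr; exact (le_abs_self μ).trans hμ
        _ ≤ _ := by gcongr
    have h2 := mul_le_mul_of_nonneg_right h1 hP.le
    have h3 : 2 * N / ρa * r * (ε * ω * χ) = (4 * N * r / ρa) * (ε * ω * χ) / 2 := by ring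
    linarith
  -- difference term
  have t1 : (N / x - N / y) * (r - 2 * z) ≤ N / ρa ^ 2 * χ := by
    have h1 : N / x - N / y = N / (x * y) * z := by rw [hz]; field_simp
    have h2 : N / (x * y) ≤ N / ρa ^ 2 := by
      rw [sq]; gcongr
    have h3 : 0 ≤ N / (x * y) := by positivity
    have h4 : z * (r - 2 * z) ≤ χ := by rw [hχe]; nlinarith
    calc (N / x - N / y) * (r - 2 * z) = N / (x * y) * (z * (r - 2 * z)) := by rw [h1]; ring
      _ ≤ N / (x * y) * χ := by gcongr
      _ ≤ _ := by gcongr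
  have t2 : (N / x - N / y) * (r - 2 * z) * (ε * ω ^ 2) ≤ N / ρa ^ 2 * χ * (ε * ω ^ 2) := by gcongr
  have hE1 : 0 ≤ 8 * d * r ^ 2 - E * ω + E ^ 2 / (32 * d * r ^ 2) * ω ^ 2 := by
    have : 8 * d * r ^ 2 - E * ω + E ^ 2 / (32 * d * r ^ 2) * ω ^ 2
       = (16 * d * r ^ 2 - E * ω) ^ 2 / (32 * d * r ^ 2) := by field_simp; ring
    rw [this]; positivity
  have key : d * ((ε * (8 * μ ^ 2 - 4 * ω) * χ) - (4 * N * r / ρa) * (ε * ω * χ) - N / ρa ^ 2 * χ * (ε * ω ^ 2))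
      ≤ d * (L + N / x * A1 + N / y * B1) := by
    apply mul_le_mul_of_nonneg_left _ hd.le
    have : N / x * A1 + N / y * B1 = (N / x + N / y) * (-2 * ε * ω * μ * χ) - (N / x - N / y) * (r - 2 * z) * (ε * ω ^ 2) := by
      rw [hA, hB]; ring
    linarith
  have fin := mul_nonneg hE1 (mul_pos hε hχ).le
  have hμ2 : μ ^ 2 = r ^ 2 - ω := by linarith
  rw [hμ2] at key
  have hEω : E * ω * (ε * χ) = (4 * r * σ) * (ε * ω * χ) + d * (12 * (ε * ω * χ) + (4 * N * r / ρa) * (ε * ω * χ)) := by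
    rw [hE]; ring
  have e1 : d * N / ρa ^ 2 * (ε * ω ^ 2 * χ) = d * (N / ρa ^ 2 * χ * (ε * ω ^ 2)) := by ring
  linear_combination key + fin - hEω - e1

lemma bb_le {ε ξ r x y : ℝ} (hε : 0 ≤ ε) (hr : 0 < r) (hxy : x ≤ y) : bb ε ξ r x y ≤ ε * r ^ 5 * (y - x) := by
  unfold bb
  have h1 : max (r ^ 2 - ((x + y) / 2 - ξ) ^ 2) 0 ≤ r ^ 2 := max_le (by nlinarith [sq_nonneg ((x + y) / 2 - ξ)]) (by positivity)
  have h2 : max ((y - x) * (r - (y - x))) 0 ≤ (y - x) * r := max_le (by nlinarith) (by nlinarith)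
  have h3 : 0 ≤ y - x := by linarith
  calc _ ≤ ε * (r ^ 2) ^ 2 * ((y - x) * r) := by gcongr
    _ = _ := by ring

lemma strict1 {n : ℕ} {R T d : ℝ} {w S : ℝ → ℝ → ℝ} (W : Rad n R T d w S)
    (hS : ∀ t ∈ Ioo 0 T, ∀ x ∈ Ioo 0 R, ∀ y ∈ Ioo 0 R, x ≤ y → S t y ≤ S t x)
    {t1 ρs m0 : ℝ} (ht1 : t1 ∈ Ioo 0 T) (hρs : ρs ∈ Ioo 0 R) (hm0 : m0 ∈ Ioo 0 R)
    (hneg : deriv (w t1) ρs < 0) :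
    ∃ r0 > 0, ∀ r, 0 < r → r ≤ r0 → ∀ t0 ∈ Ioo t1 T, ∃ ε > 0, ∀ x y, 0 ≤ x → x ≤ y → y ≤ R →
      bb ε m0 r x y ≤ w t0 x - w t0 y := by
  have hd := W.hd
  have hN : (0:ℝ) ≤ (n:ℝ) - 1 := by
    have : (1:ℝ) ≤ n := by exact_mod_cast W.hn
    linarith
  obtain ⟨N, hNe⟩ : ∃ N : ℝ, N = (n:ℝ) - 1 := ⟨_, rfl⟩
  rw [← hNe] at hN
  obtain ⟨lo, hlo⟩ : ∃ lo, lo = min ρs m0 := ⟨_, rfl⟩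
  obtain ⟨hi, hhi⟩ : ∃ hi, hi = max ρs m0 := ⟨_, rfl⟩
  have lo0 : 0 < lo := by rw [hlo]; exact lt_min hρs.1 hm0.1
  have hiR : hi < R := by rw [hhi]; exact max_lt hρs.2 hm0.2
  have lo1 : lo ≤ ρs := by rw [hlo]; exact min_le_left _ _
  have lo2 : lo ≤ m0 := by rw [hlo]; exact min_le_right _ _
  have hi1 : ρs ≤ hi := by rw [hhi]; exact le_max_left _ _
  have hi2 : m0 ≤ hi := by rw [hhi]; exact le_max_right _ _
  -- derivative bound near ρs
  obtain ⟨c, hce⟩ : ∃ c, c = - deriv (w t1) ρs / 2 := ⟨_, rfl⟩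
  have hc : 0 < c := by rw [hce]; linarith
  have hev : ∀ᶠ x in nhds ρs, deriv (w t1) x < -c :=
    (W.d2 t1 ht1 ρs hρs).continuousAt.eventually (gt_mem_nhds (by rw [hce]; linarith))
  obtain ⟨r1, hr1, hball⟩ := Metric.eventually_nhds_iff.mp hev
  refine ⟨min (min (lo / 4) ((R - hi) / 4)) (r1 / 2), lt_min (lt_min (by linarith) (by linarith)) (by linarith), ?_⟩
  intro r hr hrr0 t0 ht0
  have hrlo : r ≤ lo / 4 := hrr0.trans ((min_le_left _ _).trans (min_le_left _ _))
  have hrhi : r ≤ (R - hi) / 4 := hrr0.trans ((min_le_left _ _).trans (min_le_right _ _))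
  have hrr1 : r ≤ r1 / 2 := hrr0.trans (min_le_right _ _)
  have ht10 : t1 < t0 := ht0.1
  have hτ : 0 < t0 - t1 := by linarith
  -- path
  obtain ⟨k, hk⟩ : ∃ k, k = (m0 - ρs) / (t0 - t1) := ⟨_, rfl⟩
  have hkm : k * (t0 - t1) = m0 - ρs := by rw [hk]; field_simp
  have hpath : ∀ t ∈ Icc t1 t0, lo ≤ ρs + k * (t - t1) ∧ ρs + k * (t - t1) ≤ hi := by
    intro t ht
    have a1 : 0 ≤ t - t1 := by linarith [ht.1]
    have a2 : 0 ≤ t0 - t := by linarith [ht.2]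
    have e : (ρs + k * (t - t1)) * (t0 - t1) = ρs * (t0 - t) + m0 * (t - t1) := by linear_combination (t - t1) * hkm
    constructor
    · apply le_of_mul_le_mul_right _ hτ
      rw [e]; nlinarith
    · apply le_of_mul_le_mul_right _ hτ
      rw [e]; nlinarith
  obtain ⟨ρa, hρa⟩ : ∃ ρa, ρa = lo / 2 := ⟨_, rfl⟩
  have hρa0 : 0 < ρa := by rw [hρa]; linarith
  obtain ⟨ρb, hρb⟩ : ∃ ρb, ρb = (hi + R) / 2 := ⟨_, rfl⟩
  have hρbR : ρb < R := by linarith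
  obtain ⟨E, hE⟩ : ∃ E, E = 4 * r * |k| + d * (12 + 4 * N * r / ρa) := ⟨_, rfl⟩
  obtain ⟨Λ, hΛ⟩ : ∃ Λ, Λ = d * N / ρa ^ 2 + E ^ 2 / (32 * d * r ^ 2) := ⟨_, rfl⟩
  obtain ⟨ε, hε⟩ : ∃ ε, ε = c / r ^ 5 := ⟨_, rfl⟩
  have hε0 : 0 < ε := by rw [hε]; positivity
  obtain ⟨K, hK⟩ : ∃ K : Set (ℝ × ℝ), K = (Icc ρa ρb ×ˢ Icc ρa ρb) ∩ {z | z.1 ≤ z.2} := ⟨_, rfl⟩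
  have hKc : IsCompact K := by
    rw [hK]
    exact (isCompact_Icc.prod isCompact_Icc).inter_right (isClosed_le continuous_fst continuous_snd)
  have hsupp : ∀ e t x y, t ∈ Icc t1 t0 → bb e (ρs + k * (t - t1)) r x y ≠ 0 →
      ρa < x ∧ y < ρb := by
    intro e t x y ht hb
    obtain ⟨_, _, h3, h4, h5⟩ := bb_supp hr hb
    rw [abs_lt] at h3
    obtain ⟨p1, p2⟩ := hpath t ht
    constructor <;> linarith
  have hmono : ∀ t ∈ Icc t1 t0, ∀ x y, 0 ≤ x → x ≤ y → y ≤ R → w t y ≤ w t x := by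
    intro t ht x y h1 h2 h3
    exact W.mono t ⟨by linarith [ht.1, ht1.1], by linarith [ht.2, ht0.2]⟩ ⟨h1, h2.trans h3⟩ ⟨h1.trans h2, h3⟩ h2
  have main : ∀ η > 0, ∀ t ∈ Icc t1 t0, ∀ z ∈ K, 0 < w t z.1 + (- w t z.2) -
      bb (ε * Real.exp (-Λ * (t - t1))) (ρs + k * (t - t1)) r z.1 z.2 + η * (1 + (t - t1)) := by
    intro η hη
    apply first_touch hKc
    · have hs : ∀ z ∈ Icc t1 t0 ×ˢ K, (z.1, z.2.1) ∈ Ico 0 T ×ˢ Icc 0 R ∧ (z.1, z.2.2) ∈ Ico 0 T ×ˢ Icc 0 R := by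
        rintro ⟨t, x, y⟩ ⟨h1, h2⟩
        rw [hK] at h2
        have := h2.1.1; have := h2.1.2; simp only [mem_Icc] at *
        refine ⟨⟨⟨?_, ?_⟩, ?_, ?_⟩, ⟨⟨?_, ?_⟩, ?_, ?_⟩⟩ <;> simp only <;> linarith [ht1.1, ht0.2]
      have c1 : ContinuousOn (fun z : ℝ × ℝ × ℝ => w z.1 z.2.1) (Icc t1 t0 ×ˢ K) :=
        W.cont.comp (f := fun z : ℝ × ℝ × ℝ => (z.1, z.2.1)) (by fun_prop) (fun z hz => (hs z hz).1)
      have c2 : ContinuousOn (fun z : ℝ × ℝ × ℝ => w z.1 z.2.2) (Icc t1 t0 ×ˢ K) :=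
        W.cont.comp (f := fun z : ℝ × ℝ × ℝ => (z.1, z.2.2)) (by fun_prop) (fun z hz => (hs z hz).2)
      have c3 : Continuous (fun z : ℝ × ℝ × ℝ => bb (ε * Real.exp (-Λ * (z.1 - t1))) (ρs + k * (z.1 - t1)) r z.2.1 z.2.2) := by
        unfold bb; fun_prop
      exact ((c1.add c2.neg).sub c3.continuousOn).add (by fun_prop)
    · rintro ⟨x, y⟩ hz
      rw [hK] at hz
      have hxy : x ≤ y := hz.2
      have hx1 : ρa ≤ x := hz.1.1.1
      have hy1 : y ≤ ρb := hz.1.2.2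
      simp only [sub_self, mul_zero, Real.exp_zero, mul_one, add_zero]
      by_cases hb : bb ε ρs r x y = 0
      · rw [hb]
        have := hmono t1 ⟨le_rfl, ht10.le⟩ x y (by linarith) hxy (by linarith)
        linarith
      · obtain ⟨_, _, h3, h4, h5⟩ := bb_supp hr hb
        rw [abs_lt] at h3
        have hIcc : Icc x y ⊆ Ioo 0 R := fun s hs => ⟨by linarith [hs.1], by linarith [hs.2]⟩
        have mv := (convex_Icc x y).image_sub_le_mul_sub_of_deriv_le (f := w t1) (C := -c)
          (fun s hs => (W.d1 t1 ht1 s (hIcc hs)).continuousAt.continuousWithinAt)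
          (fun s hs => (W.d1 t1 ht1 s (hIcc (interior_subset hs))).differentiableAt.differentiableWithinAt)
          (fun s hs => by
            have hs' := interior_subset hs
            refine (hball ?_).le
            rw [Real.dist_eq, abs_lt]
            constructor <;> linarith [hs'.1, hs'.2]) x ⟨le_rfl, hxy⟩ y ⟨hxy, le_rfl⟩ hxy
        have hb2 := bb_le (ξ := ρs) hε0.le hr hxy
        have : ε * r ^ 5 = c := by rw [hε]; field_simp
        rw [this] at hb2
        linarith
    · rintro t ht ⟨x, y⟩ hz h0 hnn
      rw [hK] at hz
      have hxy : x ≤ y := hz.2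
      have hx1 : ρa ≤ x := hz.1.1.1
      have hy1 : y ≤ ρb := hz.1.2.2
      have htI : t ∈ Icc t1 t0 := ⟨ht.1.le, ht.2⟩
      have htT : t ∈ Ioo 0 T := ⟨by linarith [ht1.1, ht.1], by linarith [ht.2, ht0.2]⟩
      have htt1 : 0 < t - t1 := by linarith [ht.1]
      simp only at h0
      have hb : bb (ε * Real.exp (-Λ * (t - t1))) (ρs + k * (t - t1)) r x y ≠ 0 := by
        intro hb
        rw [hb] at h0
        have := hmono t htI x y (by linarith) hxy (by linarith)
        have : 0 < η * (1 + (t - t1)) := by positivity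
        linarith
      obtain ⟨hax, hby⟩ := hsupp _ t x y htI hb
      obtain ⟨hω, hχ, hμ, hxy', hzr⟩ := bb_supp hr hb
      have hxI : x ∈ Ioo 0 R := ⟨by linarith, by linarith⟩
      have hyI : y ∈ Ioo 0 R := ⟨by linarith, by linarith⟩
      have hKn : K ∈ nhds (x, y) := by
        rw [hK]
        apply inter_mem
        · exact prod_mem_nhds (Icc_mem_nhds hax (by linarith)) (Icc_mem_nhds (by linarith) hby)
        · exact (isOpen_lt continuous_fst continuous_snd).mem_nhds hxy' |> fun h => mem_of_superset h (fun z hz => le_of_lt hz)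
      obtain ⟨q1, q2, q3⟩ := two_point (A := w t) (B := fun s => - w t s) (A1 := deriv (w t)) (B1 := fun s => - deriv (w t) s)
        (A2 := deriv (deriv (w t)) x) (B2 := - deriv (deriv (w t)) y)
        (by filter_upwards [Ioo_mem_nhds hxI.1 hxI.2] with s hs using W.d1 t htT s hs)
        (W.d2 t htT x hxI)
        (by filter_upwards [Ioo_mem_nhds hyI.1 hyI.2] with s hs using (W.d1 t htT s hs).neg)
        (W.d2 t htT y hyI).neg hω hχ h0
        (by filter_upwards [hKn] with z hz using hnn t ⟨ht.1.le, le_rfl⟩ z hz)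
      -- time derivative
      obtain ⟨χ, hχe⟩ : ∃ χ, χ = (y - x) * (r - (y - x)) := ⟨_, rfl⟩
      have dξ : HasDerivAt (fun s => ρs + k * (s - t1)) k t := by
        have : HasDerivAt (fun s => ρs + k * (s - t1)) _ t := (((hasDerivAt_id t).sub_const t1).const_mul k).const_add ρs
        exact this.congr_deriv (by simp)
      have dω : HasDerivAt (fun s => r ^ 2 - ((x + y) / 2 - (ρs + k * (s - t1))) ^ 2) (2 * ((x + y) / 2 - (ρs + k * (t - t1))) * k) t := by
        have : HasDerivAt (fun s => r ^ 2 - ((x + y) / 2 - (ρs + k * (s - t1))) ^ 2) _ t :=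
          ((dξ.const_sub ((x + y) / 2)).pow 2).const_sub (r ^ 2)
        exact this.congr_deriv (by norm_num)
      have dE : HasDerivAt (fun s => ε * Real.exp (-Λ * (s - t1))) (-Λ * (ε * Real.exp (-Λ * (t - t1)))) t := by
        have : HasDerivAt (fun s => ε * Real.exp (-Λ * (s - t1))) _ t :=
          ((((hasDerivAt_id t).sub_const t1).const_mul (-Λ)).exp).const_mul ε
        exact this.congr_deriv (by simp only [id]; ring)
      have dη : HasDerivAt (fun s => η * (1 + (s - t1))) η t := by
        have : HasDerivAt (fun s => η * (1 + (s - t1))) _ t :=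
          ((((hasDerivAt_id t).sub_const t1).const_add 1).const_mul η)
        exact this.congr_deriv (by simp)
      have dtot := (((W.dt t htT x hxI).add (W.dt t htT y hyI).neg).sub ((dE.mul (dω.pow 2)).mul_const χ)).add dη
      have htime := left_deriv_nonpos ht.1 dtot (by
          rw [← h0, bb_eq hω.le hχ.le, hχe]; simp) (by
          have hev : ∀ᶠ s in nhdsWithin t (Iio t), 0 < r ^ 2 - ((x + y) / 2 - (ρs + k * (s - t1))) ^ 2 :=
            (dω.continuousAt.eventually (lt_mem_nhds hω)).filter_mono nhdsWithin_le_nhds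
          filter_upwards [hev, Ioo_mem_nhdsLT ht.1] with s hs hs2
          have := hnn s ⟨hs2.1.le, hs2.2.le⟩ (x, y) (by rw [hK]; exact hz)
          simp only at this
          rw [bb_eq hs.le hχ.le, ← hχe] at this
          simpa using this)
      have hSS := hS t htT x hxI y hyI hxy
      obtain ⟨e, he⟩ : ∃ e, e = ε * Real.exp (-Λ * (t - t1)) := ⟨_, rfl⟩
      have he0 : 0 < e := by rw [he]; positivity
      obtain ⟨μ, hμe⟩ : ∃ μ, μ = (x + y) / 2 - (ρs + k * (t - t1)) := ⟨_, rfl⟩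
      obtain ⟨ω, hωe⟩ : ∃ ω, ω = r ^ 2 - μ ^ 2 := ⟨_, rfl⟩
      rw [← he, ← hμe, ← hχe, ← hωe] at q1 q2 q3
      rw [← hμe, ← hωe] at hω
      rw [← hμe] at hμ
      have sp := spatial_alg (A1 := deriv (w t) x) (B1 := - deriv (w t) y)
        (L := deriv (deriv (w t)) x + -deriv (deriv (w t)) y) he0 hρa0 hr hN hd (abs_nonneg k)
        hx1 rfl (by linarith : 0 < y - x) hχe (by rw [hχe]; exact hχ) hωe hω hμ.le q1 q2 q3 hE
      rw [← hΛ] at sp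
      simp only [← he, ← hμe, ← hωe, ← hNe] at htime
      have hχ0 : 0 < χ := by rw [hχe]; exact hχ
      have hdr : e * ω * χ * (μ * k) ≤ e * ω * χ * (r * |k|) := by
        apply mul_le_mul_of_nonneg_left _ (by positivity)
        calc μ * k ≤ |μ * k| := le_abs_self _
          _ = |μ| * |k| := abs_mul _ _
          _ ≤ _ := by gcongr
      norm_num at htime
      rw [← hμe, ← hωe] at htime
      linarith
  -- conclusion
  refine ⟨ε * Real.exp (-Λ * (t0 - t1)), by positivity, ?_⟩
  intro x y hx hxy hy
  have ht0I : t0 ∈ Icc t1 t0 := ⟨ht10.le, le_rfl⟩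
  have hm0e : ρs + k * (t0 - t1) = m0 := by linarith
  by_cases hb : bb (ε * Real.exp (-Λ * (t0 - t1))) m0 r x y = 0
  · rw [hb]
    have := hmono t0 ht0I x y hx hxy hy
    linarith
  · have hs := hsupp (ε * Real.exp (-Λ * (t0 - t1))) t0 x y ht0I (by rw [hm0e]; exact hb)
    apply le_of_forall_pos_le_add
    intro η hη
    have := main (η / (1 + (t0 - t1))) (by positivity) t0 ht0I (x, y) (by
      rw [hK]; exact ⟨⟨⟨hs.1.le, by linarith⟩, ⟨by linarith, hs.2.le⟩⟩, hxy⟩)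
    rw [hm0e, div_mul_cancel₀ _ (by positivity)] at this
    simp only at this
    linarith

lemma react {ux uy vx vy κ κ' p θ B : ℝ} (hux : 0 < ux) (huy : 0 < uy) (hvx : 0 < vx) (hvy : 0 < vy)
    (hκ : 0 < κ) (hκ' : 0 < κ') (hp : 0 < p) (hθ0 : 0 ≤ θ) (hθ1 : θ ≤ 1) (hB : 0 ≤ B) (hB1 : B ≤ 1)
    (h1 : uy ^ (-κ) = ux ^ (-κ) + B) (h2 : vx ^ (-κ') + B ≤ vy ^ (-κ'))
    (h3 : θ * ux ^ κ ≤ vx ^ κ') (h4 : 2 + 1 / κ ≤ θ * p / κ') (h5 : ux ^ (-κ) ≤ 1) :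
    1 / 2 * B * (ux ^ (-κ - 1) * vx ^ p) ≤ ux ^ (-κ - 1) * vx ^ p - uy ^ (-κ - 1) * vy ^ p := by
  obtain ⟨X, hX⟩ : ∃ X, X = B * ux ^ κ := ⟨_, rfl⟩
  obtain ⟨X', hX'⟩ : ∃ X', X' = B * vx ^ κ' := ⟨_, rfl⟩
  have hX0 : 0 ≤ X := by rw [hX]; positivity
  have hX'0 : 0 ≤ X' := by rw [hX']; positivity
  have hXX : θ * X ≤ X' := by rw [hX, hX']; nlinarith
  have g1 : ux ^ (-κ) + B = ux ^ (-κ) * (1 + X) := by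
    rw [hX, Real.rpow_neg hux.le]; field_simp
  have g2 : vx ^ (-κ') + B = vx ^ (-κ') * (1 + X') := by
    rw [hX', Real.rpow_neg hvx.le]; field_simp
  have pw : ∀ z : ℝ, 0 < z → ∀ k e : ℝ, 0 < k → (z ^ (-k)) ^ (-e / k) = z ^ e := by
    intro z hz k e hk
    rw [← Real.rpow_mul hz.le]; congr 1; field_simp
  have a1 : uy ^ (-κ - 1) = ux ^ (-κ - 1) * (1 + X) ^ (1 + 1 / κ) := by
    rw [← pw uy huy κ (-κ - 1) hκ, h1, g1, Real.mul_rpow (by positivity) (by positivity), pw ux hux κ _ hκ]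
    congr 2; field_simp; ring
  have a2 : vy ^ p ≤ vx ^ p * (1 + X') ^ (-p / κ') := by
    rw [← pw vy hvy κ' p hκ']
    calc (vy ^ (-κ')) ^ (-p / κ') ≤ (vx ^ (-κ') * (1 + X')) ^ (-p / κ') := by
          apply Real.rpow_le_rpow_of_nonpos (by positivity) (by rw [← g2]; exact h2)
          rw [neg_div]; have : 0 < p / κ' := by positivity
          linarith
      _ = _ := by rw [Real.mul_rpow (by positivity) (by positivity), pw vx hvx κ' _ hκ']
  have a3 : (1 + X') ^ (-p / κ') ≤ (1 + X) ^ (-(2 + 1 / κ)) := by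
    have b1 : (1 + X) ^ θ ≤ 1 + X' := by
      have := rpow_one_add_le_one_add_mul_self (s := X) (by linarith) hθ0 hθ1
      linarith
    have hneg : -p / κ' ≤ 0 := by
      rw [neg_div]; have : 0 < p / κ' := by positivity
      linarith
    calc (1 + X') ^ (-p / κ') ≤ ((1 + X) ^ θ) ^ (-p / κ') :=
          Real.rpow_le_rpow_of_nonpos (by positivity) b1 hneg
      _ = (1 + X) ^ (-(θ * p / κ')) := by rw [← Real.rpow_mul (by positivity)]; congr 1; ring
      _ ≤ _ := Real.rpow_le_rpow_of_exponent_le (by linarith) (by linarith)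
  have a4 : (1 + X) ^ (1 + 1 / κ) * (1 + X) ^ (-(2 + 1 / κ)) = (1 + X)⁻¹ := by
    rw [← Real.rpow_add (by positivity), ← Real.rpow_neg_one]; congr 1; ring
  have hF : 0 < ux ^ (-κ - 1) * vx ^ p := by positivity
  have a5 : uy ^ (-κ - 1) * vy ^ p ≤ (ux ^ (-κ - 1) * vx ^ p) * (1 + X)⁻¹ := by
    rw [a1]
    calc ux ^ (-κ - 1) * (1 + X) ^ (1 + 1 / κ) * vy ^ p
        ≤ ux ^ (-κ - 1) * (1 + X) ^ (1 + 1 / κ) * (vx ^ p * (1 + X) ^ (-(2 + 1 / κ))) := by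
          gcongr
          exact a2.trans (by gcongr)
      _ = (ux ^ (-κ - 1) * vx ^ p) * ((1 + X) ^ (1 + 1 / κ) * (1 + X) ^ (-(2 + 1 / κ))) := by ring
      _ = _ := by rw [a4]
  have a6 : 1 / 2 * B ≤ 1 - (1 + X)⁻¹ := by
    have hg : 0 < ux ^ (-κ) := by positivity
    have e : 1 - (1 + X)⁻¹ = B / (ux ^ (-κ) + B) := by
      rw [g1]
      have : ux ^ (-κ) * X = B := by rw [hX, Real.rpow_neg hux.le]; field_simp
      rw [← this]; field_simp; ring
    rw [e, le_div_iff₀ (by linarith)]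
    nlinarith
  have a7 := mul_le_mul_of_nonneg_right a6 hF.le
  linarith

set_option maxHeartbeats 1000000 in
lemma touch {n : ℕ} {R T p q d1 d2 α β : ℝ} {u v : ℝ → ℝ → ℝ}
    (H : Sys n R T p q d1 d2 α β u v) {κ κ' θ ρa r ε η Λ0 Λ1 E m0 a t x y : ℝ}
    (hκ : 0 < κ) (hκ' : 0 < κ') (hθ0 : 0 ≤ θ) (hθ1 : θ ≤ 1) (hθ2 : 2 + 1 / κ ≤ θ * p / κ')
    (hρa : 0 < ρa) (hr : 0 < r) (hε : 0 < ε) (hε1 : ε ≤ 1) (hη : 0 < η)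
    (hE : E = 4 * r * 0 + d1 * (12 + 4 * ((n:ℝ) - 1) * r / ρa))
    (hΛ0 : Λ0 = d1 * ((n:ℝ) - 1) / ρa ^ 2 + E ^ 2 / (32 * d1 * r ^ 2))
    (ht : t ∈ Ioo 0 T) (hat : a < t) (hx : ρa ≤ x) (hyR : y < R)
    (hb : bb ε m0 r x y ≠ 0) (hb1 : bb ε m0 r x y ≤ 1)
    (huy : 0 < u t y) (hvy : 0 < v t y) (hG : u t x ^ (-κ) ≤ 1) (huv : θ * u t x ^ κ ≤ v t x ^ κ')
    (h0 : - (u t x) ^ (-κ) + (u t y) ^ (-κ) - bb ε m0 r x y + η * Real.exp (Λ1 * (t - a)) = 0)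
    (hsp : ∀ᶠ z : ℝ × ℝ in nhds (x, y),
      0 ≤ - (u t z.1) ^ (-κ) + (u t z.2) ^ (-κ) - bb ε m0 r z.1 z.2 + η * Real.exp (Λ1 * (t - a)))
    (htm : ∀ᶠ s in nhdsWithin t (Iio t),
      0 ≤ - (u s x) ^ (-κ) + (u s y) ^ (-κ) - bb ε m0 r x y + η * Real.exp (Λ1 * (s - a)))
    (hH : 0 ≤ - (v t x) ^ (-κ') + (v t y) ^ (-κ') - bb ε m0 r x y + η * Real.exp (Λ1 * (t - a)))
    (hbig : Λ0 + 8 * d1 * ((κ + 1) / κ) * r ^ 4 * u t x ^ κ ≤ κ / 2 * (u t x ^ (-κ - 1) * v t x ^ p))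
    (hΛ : Λ0 + 8 * d1 * ((κ + 1) / κ) * r ^ 4 * u t x ^ κ < Λ1) : False := by
  have hd := H.U.hd
  have hp := H.hp
  have hN : (0:ℝ) ≤ (n:ℝ) - 1 := by
    have : (1:ℝ) ≤ n := by exact_mod_cast H.U.hn
    linarith
  obtain ⟨N, hNe⟩ : ∃ N : ℝ, N = (n:ℝ) - 1 := ⟨_, rfl⟩
  rw [← hNe] at hN hE hΛ0
  obtain ⟨hω, hχ, hμ, hxy, hzr⟩ := bb_supp hr hb
  have hxI : x ∈ Ioo 0 R := ⟨by linarith, by linarith⟩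
  have hyI : y ∈ Ioo 0 R := ⟨by linarith, by linarith⟩
  have htI : t ∈ Ico 0 T := ⟨ht.1.le, ht.2⟩
  have hUm : u t y ≤ u t x := H.U.mono t htI ⟨hxI.1.le, hxI.2.le⟩ ⟨hyI.1.le, hyI.2.le⟩ hxy.le
  have hVm : v t y ≤ v t x := H.V.mono t htI ⟨hxI.1.le, hxI.2.le⟩ ⟨hyI.1.le, hyI.2.le⟩ hxy.le
  have hux : 0 < u t x := by linarith
  have hvx : 0 < v t x := by linarith
  obtain ⟨ζ, hζ⟩ : ∃ ζ, ζ = η * Real.exp (Λ1 * (t - a)) := ⟨_, rfl⟩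
  have hζ0 : 0 < ζ := by rw [hζ]; positivity
  -- derivatives of G
  have dG : ∀ s ∈ Ioo 0 R, 0 < u t s → HasDerivAt (fun s => u t s ^ (-κ)) (deriv (u t) s * -κ * u t s ^ (-κ - 1)) s := by
    intro s hs hus
    exact (H.U.d1 t ht s hs).rpow_const (Or.inl hus.ne')
  have dG2 : ∀ s ∈ Ioo 0 R, 0 < u t s → HasDerivAt (fun s => deriv (u t) s * -κ * u t s ^ (-κ - 1))
      (deriv (deriv (u t)) s * -κ * u t s ^ (-κ - 1) + deriv (u t) s * -κ * (deriv (u t) s * (-κ - 1) * u t s ^ (-κ - 1 - 1))) s := by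
    intro s hs hus
    exact ((H.U.d2 t ht s hs).mul_const (-κ)).mul ((H.U.d1 t ht s hs).rpow_const (Or.inl hus.ne'))
  have posn : ∀ s ∈ Ioo 0 R, 0 < u t s → ∀ᶠ s' in nhds s, HasDerivAt (fun s => u t s ^ (-κ)) (deriv (u t) s' * -κ * u t s' ^ (-κ - 1)) s' := by
    intro s hs hus
    filter_upwards [Ioo_mem_nhds hs.1 hs.2, (H.U.d1 t ht s hs).continuousAt.eventually (lt_mem_nhds hus)] with s' h1 h2
    exact dG s' h1 h2
  obtain ⟨q1, q2, q3⟩ := two_point (posn x hxI hux |>.mono fun s h => h.neg) (dG2 x hxI hux).neg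
    (posn y hyI huy) (dG2 y hyI huy) hω hχ h0 hsp
  -- time
  have dη : HasDerivAt (fun s => η * Real.exp (Λ1 * (s - a))) (Λ1 * ζ) t := by
    have : HasDerivAt (fun s => η * Real.exp (Λ1 * (s - a))) _ t :=
      ((((hasDerivAt_id t).sub_const a).const_mul Λ1).exp).const_mul η
    exact this.congr_deriv (by rw [hζ]; simp only [id]; ring)
  have dtot : HasDerivAt (fun s => - (u s x) ^ (-κ) + (u s y) ^ (-κ) - bb ε m0 r x y + η * Real.exp (Λ1 * (s - a))) _ t :=
    (((((H.U.dt t ht x hxI).rpow_const (p := -κ) (Or.inl hux.ne')).neg).add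
    ((H.U.dt t ht y hyI).rpow_const (p := -κ) (Or.inl huy.ne'))).sub_const (bb ε m0 r x y)).add dη
  have htime := left_deriv_nonpos hat dtot h0 htm
  rw [← hNe] at htime
  rw [← hζ] at h0 hH
  -- reaction
  obtain ⟨b, hbe⟩ : ∃ b, b = bb ε m0 r x y := ⟨_, rfl⟩
  rw [← hbe] at h0 hH hb1
  have hGm : u t x ^ (-κ) ≤ u t y ^ (-κ) := Real.rpow_le_rpow_of_nonpos huy hUm (by linarith)
  have hrea := react hux huy hvx hvy hκ hκ' (by linarith : 0 < p) hθ0 hθ1 (B := b - ζ) (by linarith) (by linarith)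
    (by linarith) (by linarith) huv hθ2 hG
  -- abbreviations
  rw [bb_eq hω.le hχ.le] at hbe
  obtain ⟨χ, hχe⟩ : ∃ χ, χ = (y - x) * (r - (y - x)) := ⟨_, rfl⟩
  obtain ⟨μ, hμe⟩ : ∃ μ, μ = (x + y) / 2 - m0 := ⟨_, rfl⟩
  obtain ⟨ω, hωe⟩ : ∃ ω, ω = r ^ 2 - μ ^ 2 := ⟨_, rfl⟩
  obtain ⟨z, hz⟩ : ∃ z, z = y - x := ⟨_, rfl⟩
  rw [← hμe, ← hχe, ← hωe, ← hz] at q1 q2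
  rw [← hμe, ← hχe, ← hωe] at q3 hbe
  rw [← hμe, ← hωe] at hω
  rw [← hμe] at hμ
  rw [← hχe] at hχ
  rw [← hz] at hχe hzr
  have hz0 : 0 < z := by linarith
  obtain ⟨Gx, hGx⟩ : ∃ Gx, Gx = deriv (u t) x * -κ * u t x ^ (-κ - 1) := ⟨_, rfl⟩
  obtain ⟨Gy, hGy⟩ : ∃ Gy, Gy = deriv (u t) y * -κ * u t y ^ (-κ - 1) := ⟨_, rfl⟩
  have sp := spatial_alg hε hρa hr hN hd le_rfl hx hz hz0 hχe hχ hωe hω hμ.le q1 q2 q3 hE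
  rw [← hΛ0, ← hbe] at sp
  simp only [← hGx, ← hGy] at q1 q2 sp
  -- gradient terms
  have gr : ∀ s, 0 < u t s → deriv (u t) s * -κ * (deriv (u t) s * (-κ - 1) * u t s ^ (-κ - 1 - 1)) =
      (κ + 1) / κ * u t s ^ κ * (deriv (u t) s * -κ * u t s ^ (-κ - 1)) ^ 2 := by
    intro s hs
    have : u t s ^ (-κ - 1 - 1) = u t s ^ κ * (u t s ^ (-κ - 1)) ^ 2 := by
      rw [← Real.rpow_natCast, ← Real.rpow_mul hs.le, ← Real.rpow_add hs]; congr 1; push_cast; ring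
    rw [this]; field_simp; ring
  rw [gr x hux, gr y huy, ← hGx, ← hGy] at sp
  have hω2 : ω ≤ r ^ 2 := by rw [hωe]; linarith [sq_nonneg μ]
  have hKm : u t y ^ κ ≤ u t x ^ κ := Real.rpow_le_rpow huy.le hUm hκ.le
  have hKx : 0 < u t x ^ κ := by positivity
  obtain ⟨P, hP⟩ : ∃ P, P = 2 * ε * ω * μ * χ := ⟨_, rfl⟩
  obtain ⟨Q, hQ⟩ : ∃ Q, Q = ε * ω ^ 2 * (r - 2 * z) := ⟨_, rfl⟩
  have hGx' : Gx = P + Q := by rw [hP, hQ]; linarith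
  have hGy' : Gy = -P + Q := by rw [hP, hQ]; linarith
  have hb0 : 0 < b := by rw [hbe]; positivity
  have hPQ : -(2 * r ^ 4 * b) ≤ P * Q := by
    have e : P * Q = (2 * b) * (ε * (ω * (μ * (r - 2 * z)))) := by rw [hP, hQ, hbe]; ring
    have h1 : |μ * (r - 2 * z)| ≤ r * r := by
      rw [abs_mul]
      apply mul_le_mul hμ.le _ (abs_nonneg _) hr.le
      rw [abs_le]; constructor <;> linarith
    have h2 : |ε * (ω * (μ * (r - 2 * z)))| ≤ 1 * (r ^ 2 * (r * r)) := by
      rw [abs_mul, abs_mul, abs_of_pos hε, abs_of_pos hω]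
      gcongr
    have h3 := neg_le_of_abs_le h2
    rw [e]
    have h4 := mul_le_mul_of_nonneg_left h3 (by linarith : (0:ℝ) ≤ 2 * b)
    linarith
  have hgr : -(8 * r ^ 4 * b) * u t x ^ κ ≤ u t x ^ κ * Gx ^ 2 - u t y ^ κ * Gy ^ 2 := by
    have h1 : u t y ^ κ * Gy ^ 2 ≤ u t x ^ κ * Gy ^ 2 := by gcongr
    have h2 : Gx ^ 2 - Gy ^ 2 = 4 * (P * Q) := by rw [hGx', hGy']; ring
    have h3 : -(8 * r ^ 4 * b) * u t x ^ κ ≤ (4 * (P * Q)) * u t x ^ κ := by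
      apply mul_le_mul_of_nonneg_right _ hKx.le; linarith
    rw [← h2] at h3
    linarith
  have hΓ : 0 < d1 * ((κ + 1) / κ) := by positivity
  have hgr2 := mul_le_mul_of_nonneg_left hgr hΓ.le
  have hrea2 := mul_le_mul_of_nonneg_left hrea hκ.le
  obtain ⟨F, hF⟩ : ∃ F, F = u t x ^ (-κ - 1) * v t x ^ p := ⟨_, rfl⟩
  obtain ⟨Mt, hMt⟩ : ∃ Mt, Mt = Λ0 + 8 * d1 * ((κ + 1) / κ) * r ^ 4 * u t x ^ κ := ⟨_, rfl⟩
  rw [← hMt] at hbig hΛ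
  rw [← hF] at hbig
  have w1 : Mt * (b - ζ) ≤ κ / 2 * F * (b - ζ) := mul_le_mul_of_nonneg_right hbig (by linarith)
  have w2 : Mt * ζ < Λ1 * ζ := mul_lt_mul_of_pos_right hΛ hζ0
  have w3 : Mt * b = Λ0 * b + 8 * d1 * ((κ + 1) / κ) * r ^ 4 * u t x ^ κ * b := by rw [hMt]; ring
  have hF2 : κ * (1 / 2 * (b - ζ) * F) = κ / 2 * F * (b - ζ) := by ring
  rw [← hF, hF2] at hrea2
  have k1 : N / x * Gx = N / x * (deriv (u t) x * -κ * u t x ^ (-κ - 1)) := by rw [hGx]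
  have k2 : N / y * Gy = N / y * (deriv (u t) y * -κ * u t y ^ (-κ - 1)) := by rw [hGy]
  have hF4 : κ * F = κ * (u t x ^ (-κ - 1) * v t x ^ p) := by rw [hF]
  have k1' := congrArg (d1 * ·) k1
  have k2' := congrArg (d1 * ·) k2
  linarith

noncomputable def LL (n : ℕ) (d ρa r : ℝ) : ℝ :=
  d * ((n:ℝ) - 1) / ρa ^ 2 + (4 * r * 0 + d * (12 + 4 * ((n:ℝ) - 1) * r / ρa)) ^ 2 / (32 * d * r ^ 2)

def QC (n : ℕ) (p d κ κ' θ ρa r Λ1 U V : ℝ) : Prop :=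
  U ^ (-κ) ≤ 1 ∧ θ * U ^ κ ≤ V ^ κ' ∧
  LL n d ρa r + 8 * d * ((κ + 1) / κ) * r ^ 4 * U ^ κ ≤ κ / 2 * (U ^ (-κ - 1) * V ^ p) ∧
  LL n d ρa r + 8 * d * ((κ + 1) / κ) * r ^ 4 * U ^ κ < Λ1

/-- the comparison quantity -/
noncomputable def ff (κ ε m0 r η Λ1 a : ℝ) (u : ℝ → ℝ → ℝ) (t : ℝ) (z : ℝ × ℝ) : ℝ :=
  - (u t z.1) ^ (-κ) + (u t z.2) ^ (-κ) - bb ε m0 r z.1 z.2 + η * Real.exp (Λ1 * (t - a))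

def KK (ρa ρ1 : ℝ) : Set (ℝ × ℝ) := (Icc ρa ρ1 ×ˢ Icc ρa ρ1) ∩ {z | z.1 ≤ z.2}

lemma side_touch {n : ℕ} {R T p q d1 d2 α β : ℝ} {u v : ℝ → ℝ → ℝ}
    (H : Sys n R T p q d1 d2 α β u v) {κ κ' θ ρa ρ1 r ε η Λ1 m0 a t : ℝ} {z : ℝ × ℝ}
    (hκ : 0 < κ) (hκ' : 0 < κ') (hθ0 : 0 ≤ θ) (hθ1 : θ ≤ 1) (hθ2 : 2 + 1 / κ ≤ θ * p / κ')
    (hρa : 0 < ρa) (hr : 0 < r) (hε : 0 < ε) (hε1 : ε ≤ 1) (hη : 0 < η)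
    (hlo : ρa ≤ m0 - 3 * r / 2) (hhi : m0 + 3 * r / 2 ≤ ρ1) (hR : ρ1 < R)
    (ha : 0 ≤ a) (hat : a < t) (htT : t < T)
    (hz : z ∈ KK ρa ρ1) (hb1 : bb ε m0 r z.1 z.2 ≤ 1)
    (hpos : ∀ x ∈ Icc ρa ρ1, 0 < u t x ∧ 0 < v t x)
    (hQ : ∀ x ∈ Icc ρa ρ1, QC n p d1 κ κ' θ ρa r Λ1 (u t x) (v t x))
    (h0 : ff κ ε m0 r η Λ1 a u t z = 0)
    (hnn : ∀ s ∈ Icc a t, ∀ y ∈ KK ρa ρ1, 0 ≤ ff κ ε m0 r η Λ1 a u s y)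
    (hH : 0 ≤ ff κ' ε m0 r η Λ1 a v t z) : False := by
  obtain ⟨x, y⟩ := z
  have hxy : x ≤ y := hz.2
  have hxI : x ∈ Icc ρa ρ1 := hz.1.1
  have hyI : y ∈ Icc ρa ρ1 := hz.1.2
  simp only at hb1
  have hb : bb ε m0 r x y ≠ 0 := by
    intro hb
    have hm := H.U.mono t ⟨by linarith, htT⟩ (a := x) (b := y) ⟨by linarith [hxI.1], by linarith [hxI.2]⟩
      ⟨by linarith [hyI.1], by linarith [hyI.2]⟩ hxy
    have := Real.rpow_le_rpow_of_nonpos (z := -κ) (hpos y hyI).1 hm (by linarith)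
    have : 0 < η * Real.exp (Λ1 * (t - a)) := by positivity
    unfold ff at h0
    simp only at h0
    linarith
  obtain ⟨_, _, h3, h4, h5⟩ := bb_supp hr hb
  rw [abs_lt] at h3
  have hKn : KK ρa ρ1 ∈ nhds (x, y) := by
    apply inter_mem
    · exact prod_mem_nhds (Icc_mem_nhds (by linarith) (by linarith)) (Icc_mem_nhds (by linarith) (by linarith))
    · exact (isOpen_lt continuous_fst continuous_snd).mem_nhds h4 |> fun h => mem_of_superset h (fun z hz => le_of_lt hz)
  obtain ⟨Q1, Q2, Q3, Q4⟩ := hQ x hxI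
  exact touch H hκ hκ' hθ0 hθ1 hθ2 hρa hr hε hε1 hη rfl rfl ⟨by linarith, htT⟩ hat hxI.1 (by linarith) hb hb1
    (hpos y hyI).1 (hpos y hyI).2 Q1 Q2 h0
    (by filter_upwards [hKn] with z hz using hnn t ⟨hat.le, le_rfl⟩ z hz)
    (by filter_upwards [Ioo_mem_nhdsLT hat] with s hs using hnn s ⟨hs.1.le, hs.2.le⟩ (x, y) hz)
    hH Q3 Q4

lemma ff_cont {R T κ ε m0 r η Λ1 t0 t1 ρa ρ1 : ℝ} {u : ℝ → ℝ → ℝ}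
    (hu : ContinuousOn (Function.uncurry u) (Ico (0:ℝ) T ×ˢ Icc (0:ℝ) R))
    (h0 : 0 ≤ t0) (h1 : t1 < T) (ha : 0 ≤ ρa) (hR : ρ1 ≤ R)
    (hpos : ∀ t ∈ Icc t0 t1, ∀ x ∈ Icc ρa ρ1, 0 < u t x) :
    ContinuousOn (fun z : ℝ × ℝ × ℝ => ff κ ε m0 r η Λ1 t0 u z.1 z.2) (Icc t0 t1 ×ˢ KK ρa ρ1) := by
  have hs : ∀ z ∈ Icc t0 t1 ×ˢ KK ρa ρ1, (z.1, z.2.1) ∈ Ico 0 T ×ˢ Icc 0 R ∧ (z.1, z.2.2) ∈ Ico 0 T ×ˢ Icc 0 R := by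
    rintro ⟨t, x, y⟩ ⟨h1, h2⟩
    have := h2.1.1; have := h2.1.2; simp only [mem_Icc] at *
    refine ⟨⟨⟨?_, ?_⟩, ?_, ?_⟩, ⟨⟨?_, ?_⟩, ?_, ?_⟩⟩ <;> simp only <;> linarith
  have c1 : ContinuousOn (fun z : ℝ × ℝ × ℝ => u z.1 z.2.1) (Icc t0 t1 ×ˢ KK ρa ρ1) :=
    hu.comp (f := fun z : ℝ × ℝ × ℝ => (z.1, z.2.1)) (by fun_prop) (fun z hz => (hs z hz).1)
  have c2 : ContinuousOn (fun z : ℝ × ℝ × ℝ => u z.1 z.2.2) (Icc t0 t1 ×ˢ KK ρa ρ1) :=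
    hu.comp (f := fun z : ℝ × ℝ × ℝ => (z.1, z.2.2)) (by fun_prop) (fun z hz => (hs z hz).2)
  have c3 : Continuous (fun z : ℝ × ℝ × ℝ => bb ε m0 r z.2.1 z.2.2) := by
    unfold bb; fun_prop
  have k1 := c1.rpow_const (p := -κ) (fun z hz => Or.inl (hpos z.1 hz.1 z.2.1 hz.2.1.1).ne')
  have k2 := c2.rpow_const (p := -κ) (fun z hz => Or.inl (hpos z.1 hz.1 z.2.2 hz.2.1.2).ne')
  exact ((k1.neg.add k2).sub c3.continuousOn).add (by fun_prop)

lemma stage2 {n : ℕ} {R T p q d1 d2 α β : ℝ} {u v : ℝ → ℝ → ℝ}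
    (H : Sys n R T p q d1 d2 α β u v) {κ κ' θ ρa ρ1 r ε η Λ1 m0 t0 t1 : ℝ}
    (hκ : 0 < κ) (hκ' : 0 < κ') (hθ0 : 0 ≤ θ) (hθ1 : θ ≤ 1) (hθ2 : 2 + 1 / κ ≤ θ * p / κ')
    (hθ3 : 2 + 1 / κ' ≤ θ * q / κ)
    (hρa : 0 < ρa) (hr : 0 < r) (hε : 0 < ε) (hε1 : ε ≤ 1) (hη : 0 < η)
    (hlo : ρa ≤ m0 - 3 * r / 2) (hhi : m0 + 3 * r / 2 ≤ ρ1) (hR : ρ1 < R)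
    (ht0 : 0 ≤ t0) (ht1 : t1 < T)
    (hb1 : ∀ z ∈ KK ρa ρ1, bb ε m0 r z.1 z.2 ≤ 1)
    (hpos : ∀ t ∈ Icc t0 t1, ∀ x ∈ Icc ρa ρ1, 0 < u t x ∧ 0 < v t x)
    (hQ : ∀ t ∈ Icc t0 t1, ∀ x ∈ Icc ρa ρ1, QC n p d1 κ κ' θ ρa r Λ1 (u t x) (v t x))
    (hQ' : ∀ t ∈ Icc t0 t1, ∀ x ∈ Icc ρa ρ1, QC n q d2 κ' κ θ ρa r Λ1 (v t x) (u t x))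
    (i1 : ∀ z ∈ KK ρa ρ1, bb ε m0 r z.1 z.2 ≤ - (u t0 z.1) ^ (-κ) + (u t0 z.2) ^ (-κ))
    (i2 : ∀ z ∈ KK ρa ρ1, bb ε m0 r z.1 z.2 ≤ - (v t0 z.1) ^ (-κ') + (v t0 z.2) ^ (-κ')) :
    ∀ t ∈ Icc t0 t1, ∀ z ∈ KK ρa ρ1, 0 < min (ff κ ε m0 r η Λ1 t0 u t z) (ff κ' ε m0 r η Λ1 t0 v t z) := by
  apply first_touch
  · exact (isCompact_Icc.prod isCompact_Icc).inter_right (isClosed_le continuous_fst continuous_snd)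
  · exact ContinuousOn.inf (ff_cont H.U.cont ht0 ht1 hρa.le hR.le (fun t ht x hx => (hpos t ht x hx).1))
      (ff_cont H.V.cont ht0 ht1 hρa.le hR.le (fun t ht x hx => (hpos t ht x hx).2))
  · intro z hz
    have := i1 z hz
    have := i2 z hz
    unfold ff
    simp only [sub_self, mul_zero, Real.exp_zero, mul_one]
    apply lt_min <;> linarith
  · intro t ht z hz h0 hnn
    have htI : t ∈ Icc t0 t1 := ⟨ht.1.le, ht.2⟩
    have n1 : ∀ s ∈ Icc t0 t, ∀ y ∈ KK ρa ρ1, 0 ≤ ff κ ε m0 r η Λ1 t0 u s y :=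
      fun s hs y hy => (hnn s hs y hy).trans (min_le_left _ _)
    have n2 : ∀ s ∈ Icc t0 t, ∀ y ∈ KK ρa ρ1, 0 ≤ ff κ' ε m0 r η Λ1 t0 v s y :=
      fun s hs y hy => (hnn s hs y hy).trans (min_le_right _ _)
    have htt : t ∈ Icc t0 t := ⟨ht.1.le, le_rfl⟩
    have htT : t < T := by linarith [ht.2]
    rcases min_choice (ff κ ε m0 r η Λ1 t0 u t z) (ff κ' ε m0 r η Λ1 t0 v t z) with h | h
    · rw [h] at h0
      exact side_touch H hκ hκ' hθ0 hθ1 hθ2 hρa hr hε hε1 hη hlo hhi hR ht0 ht.1 htT hz (hb1 z hz)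
        (hpos t htI) (hQ t htI) h0 n1 (n2 t htt z hz)
    · rw [h] at h0
      exact side_touch H.symm hκ' hκ hθ0 hθ1 hθ3 hρa hr hε hε1 hη hlo hhi hR ht0 ht.1 htT hz (hb1 z hz)
        (fun x hx => (hpos t htI x hx).symm) (hQ' t htI) h0 n2 (n1 t htt z hz)

lemma small_lam {A B C k ν : ℝ} (hC : 0 < C) (hk : 0 < k) (hν : 0 < ν) (hν2 : ν < 1 / 2) :
    ∃ l0 > 0, ∀ l, 0 < l → l ≤ l0 → A + B * (C / l) ^ ν ≤ k * l ^ (ν - 1) := by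
  have c1 : ContinuousAt (fun l : ℝ => A * l ^ (1 - ν) + B * C ^ ν * l ^ (1 - 2 * ν)) 0 := by
    have h1 : ContinuousAt (fun l : ℝ => l ^ (1 - ν)) 0 := Real.continuousAt_rpow_const _ _ (Or.inr (by linarith))
    have h2 : ContinuousAt (fun l : ℝ => l ^ (1 - 2 * ν)) 0 := Real.continuousAt_rpow_const _ _ (Or.inr (by linarith))
    exact (h1.const_mul A).add (h2.const_mul (B * C ^ ν))
  have hk0 : (fun l : ℝ => A * l ^ (1 - ν) + B * C ^ ν * l ^ (1 - 2 * ν)) 0 < k := by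
    simp only
    rw [Real.zero_rpow (by linarith), Real.zero_rpow (by linarith)]; linarith
  have hev := c1.eventually_lt continuousAt_const hk0
  obtain ⟨l1, hl1, hl⟩ := Metric.eventually_nhds_iff.mp hev
  refine ⟨l1 / 2, by positivity, ?_⟩
  intro l hl0 hll
  have := hl (y := l) (by rw [Real.dist_eq, sub_zero, abs_of_pos hl0]; linarith)
  have hp : 0 < l ^ (ν - 1) := by positivity
  have h2 := mul_le_mul_of_nonneg_right this.le hp.le
  have e1 : l ^ (1 - ν) * l ^ (ν - 1) = 1 := by
    rw [← Real.rpow_add hl0]; simp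
  have e2 : C ^ ν * l ^ (1 - 2 * ν) * l ^ (ν - 1) = (C / l) ^ ν := by
    rw [mul_assoc, ← Real.rpow_add hl0, Real.div_rpow hC.le hl0.le, div_eq_mul_inv, ← Real.rpow_neg hl0.le]
    congr 2; ring
  calc A + B * (C / l) ^ ν = (A * l ^ (1 - ν) + B * C ^ ν * l ^ (1 - 2 * ν)) * l ^ (ν - 1) := by
        rw [← e2]; linear_combination -A * e1
    _ ≤ _ := h2

lemma quant {n : ℕ} {p d α β ν c C ρa r : ℝ} (hα : 0 < α) (hβ : 0 < β) (hp : 0 < p) (he : β * p = α + 1)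
    (hc : 0 < c) (hC : 0 < C) (hν : 0 < ν) (hν2 : ν < 1 / 2) (hd : 0 < d) :
    ∃ l0 > 0, ∀ l U V, 0 < l → l ≤ l0 → (c / l) ^ α ≤ U → U ≤ (C / l) ^ α → (c / l) ^ β ≤ V →
      (∀ Λ1, LL n d ρa r + 8 * d * ((ν / α + 1) / (ν / α)) * r ^ 4 * (C / l) ^ ν < Λ1 →
        QC n p d (ν / α) (ν / β) ((c / C) ^ ν) ρa r Λ1 U V) ∧
      (C / l) ^ (-ν - α) ≤ U ^ (-(ν / α) - 1) ∧ U ^ (-(ν / α)) ≤ (l / c) ^ ν := by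
  obtain ⟨κ, hκ⟩ : ∃ κ, κ = ν / α := ⟨_, rfl⟩
  have hκ0 : 0 < κ := by rw [hκ]; positivity
  obtain ⟨l1, hl1, hs⟩ := small_lam (A := LL n d ρa r) (B := 8 * d * ((κ + 1) / κ) * r ^ 4) hC
    (k := κ / 2 * (C ^ (-ν - α) * c ^ (α + 1))) (by positivity) hν hν2
  refine ⟨min l1 c, by positivity, ?_⟩
  intro l U V hl hll hU1 hU2 hV
  have hll1 : l ≤ l1 := hll.trans (min_le_left _ _)
  have hlc : l ≤ c := hll.trans (min_le_right _ _)
  have hcl : 0 < (c / l) ^ α := by positivity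
  have hU : 0 < U := by linarith
  have hV0 : 0 < V := lt_of_lt_of_le (by positivity) hV
  rw [← hκ]
  have k1 : U ^ κ ≤ (C / l) ^ ν := by
    calc U ^ κ ≤ ((C / l) ^ α) ^ κ := by gcongr
      _ = _ := by rw [← Real.rpow_mul (by positivity), hκ]; congr 1; field_simp
  have k2 : U ^ (-κ) ≤ (l / c) ^ ν := by
    calc U ^ (-κ) ≤ ((c / l) ^ α) ^ (-κ) := Real.rpow_le_rpow_of_nonpos hcl hU1 (by linarith)
      _ = (c / l) ^ (-ν) := by rw [← Real.rpow_mul (by positivity), hκ]; congr 1; field_simp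
      _ = _ := by rw [Real.rpow_neg (by positivity), ← Real.inv_rpow (by positivity), inv_div]
  have k3 : (C / l) ^ (-ν - α) ≤ U ^ (-κ - 1) := by
    calc (C / l) ^ (-ν - α) = ((C / l) ^ α) ^ (-κ - 1) := by
          rw [← Real.rpow_mul (by positivity), hκ]; congr 1; field_simp
      _ ≤ _ := Real.rpow_le_rpow_of_nonpos hU hU2 (by linarith)
  have hB : 0 ≤ 8 * d * ((κ + 1) / κ) * r ^ 4 := by positivity
  have k4 : LL n d ρa r + 8 * d * ((κ + 1) / κ) * r ^ 4 * U ^ κ ≤ LL n d ρa r + 8 * d * ((κ + 1) / κ) * r ^ 4 * (C / l) ^ ν := by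
    gcongr
  refine ⟨fun Λ1 hΛ => ⟨?_, ?_, ?_, by linarith⟩, k3, k2⟩
  · refine k2.trans (Real.rpow_le_one (by positivity) ?_ hν.le)
    rw [div_le_one hc]; exact hlc
  · calc (c / C) ^ ν * U ^ κ ≤ (c / C) ^ ν * (C / l) ^ ν := by gcongr
      _ = (c / l) ^ ν := by
        rw [← Real.mul_rpow (by positivity) (by positivity)]; congr 1; field_simp
      _ = ((c / l) ^ β) ^ (ν / β) := by
        rw [← Real.rpow_mul (by positivity)]; congr 1; field_simp
      _ ≤ _ := by gcongr
  · refine k4.trans ((hs l hl hll1).trans ?_)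
    have h1 : (c / l) ^ (α + 1) ≤ V ^ p := by
      rw [← he, Real.rpow_mul (by positivity)]; gcongr
    have h2 : C ^ (-ν - α) * c ^ (α + 1) * l ^ (ν - 1) = (C / l) ^ (-ν - α) * (c / l) ^ (α + 1) := by
      rw [Real.div_rpow hC.le hl.le, Real.div_rpow hc.le hl.le]
      have : l ^ (ν - 1) = (l ^ (-ν - α))⁻¹ * (l ^ (α + 1))⁻¹ := by
        rw [← Real.rpow_neg hl.le, ← Real.rpow_neg hl.le, ← Real.rpow_add hl]; congr 1; ring
      rw [this]; field_simp
    rw [mul_assoc, h2]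
    gcongr

lemma init_ineq {a b κ : ℝ} (ha : 0 < a) (hb : 0 < b) (hκ : 0 < κ) :
    κ * a ^ (-κ - 1) * (a - b) ≤ - a ^ (-κ) + b ^ (-κ) := by
  have h1 : 1 + κ * (1 - b / a) ≤ (b / a) ^ (-κ) := by
    have hba : 0 < b / a := by positivity
    rw [Real.rpow_def_of_pos hba]
    have := Real.add_one_le_exp (Real.log (b / a) * -κ)
    have := Real.log_le_sub_one_of_pos hba
    nlinarith
  rw [Real.div_rpow hb.le ha.le, le_div_iff₀ (by positivity)] at h1
  have h2 : a ^ (-κ) = a ^ (-κ - 1) * a := by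
    rw [← Real.rpow_add_one ha.ne']; congr 1; ring
  have h3 : a ^ (-κ) * (1 - b / a) = a ^ (-κ - 1) * (a - b) := by
    rw [h2]; field_simp
  nlinarith

lemma strict0 {n : ℕ} {R T d t ρ1 : ℝ} {w S : ℝ → ℝ → ℝ} (W : Rad n R T d w S)
    (ht : t ∈ Ioo (0:ℝ) T) (h1 : ρ1 ∈ Ioo (0:ℝ) R) (hpos : 0 < w t ρ1) :
    ∃ ρs ∈ Ioo (0:ℝ) R, deriv (w t) ρs < 0 := by
  have hc : ContinuousOn (w t) (Icc ρ1 R) := by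
    have : ContinuousOn (fun x : ℝ => Function.uncurry w (t, x)) (Icc ρ1 R) := by
      apply W.cont.comp (by fun_prop)
      intro x hx
      exact ⟨⟨ht.1.le, ht.2⟩, ⟨h1.1.le.trans hx.1, hx.2⟩⟩
    exact this
  obtain ⟨s, hs, he⟩ := exists_deriv_eq_slope (w t) h1.2 hc (fun x hx =>
    (W.d1 t ht x ⟨h1.1.trans hx.1, hx.2⟩).differentiableAt.differentiableWithinAt)
  refine ⟨s, ⟨h1.1.trans hs.1, hs.2⟩, ?_⟩
  rw [he, W.bc t ht]
  exact div_neg_of_neg_of_pos (by linarith) (by linarith [h1.2])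

lemma choose_nu1 {a k : ℝ} (hk : 0 < k) :
    ∀ᶠ ν in nhds (0:ℝ), 2 * ν + a ≤ (a + 1) * k ^ ν := by
  have c1 : ContinuousAt (fun ν : ℝ => 2 * ν + a) 0 := by fun_prop
  have c2 : ContinuousAt (fun ν : ℝ => (a + 1) * k ^ ν) 0 :=
    (Real.continuousAt_const_rpow hk.ne').const_mul _
  filter_upwards [c1.eventually_lt c2 (by simp)] with ν h using h.le

lemma choose_nu {a b k : ℝ} (hk : 0 < k) :
    ∃ ν, 0 < ν ∧ ν < 1 / 2 ∧ 2 * ν + a ≤ (a + 1) * k ^ ν ∧ 2 * ν + b ≤ (b + 1) * k ^ ν := by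
  have h1 := (choose_nu1 (a := a) hk).and (choose_nu1 (a := b) hk)
  obtain ⟨l, hl, h⟩ := Metric.eventually_nhds_iff.mp h1
  have hm : 0 < min (l / 2) (1 / 4) := by positivity
  have h2 := min_le_left (l / 2) (1 / 4)
  have h3 := min_le_right (l / 2) (1 / 4)
  refine ⟨min (l / 2) (1 / 4), hm, by linarith, ?_⟩
  exact h (by rw [Real.dist_eq, sub_zero, abs_of_pos hm]; linarith)

lemma init_side {w : ℝ → ℝ} {R ρa ρ1 ε εu m0 r κ K : ℝ} (ha : 0 < ρa) (h1R : ρ1 < R)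
    (hε : 0 ≤ ε) (hεu : 0 < εu) (hκ : 0 < κ) (hK : 0 < K) (hle : ε ≤ κ * K * εu)
    (hi : ∀ x y, 0 ≤ x → x ≤ y → y ≤ R → bb εu m0 r x y ≤ w x - w y)
    (hk : ∀ x ∈ Icc ρa ρ1, 0 < w x ∧ K ≤ (w x) ^ (-κ - 1)) :
    ∀ z ∈ KK ρa ρ1, bb ε m0 r z.1 z.2 ≤ - (w z.1) ^ (-κ) + (w z.2) ^ (-κ) := by
  rintro ⟨x, y⟩ ⟨⟨hx, hy⟩, hxy⟩
  simp only at hx hy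
  change x ≤ y at hxy
  simp only
  have h1 := hi x y (ha.le.trans hx.1) hxy (by linarith [hy.2])
  have hb0 : 0 ≤ bb εu m0 r x y := bb_nonneg hεu.le
  have h2 := init_ineq (hk x hx).1 (hk y hy).1 hκ
  have h3 : bb ε m0 r x y ≤ κ * K * bb εu m0 r x y := by
    have hX : 0 ≤ bb 1 m0 r x y := bb_nonneg zero_le_one
    have e1 : bb ε m0 r x y = ε * bb 1 m0 r x y := by unfold bb; ring
    have e2 : bb εu m0 r x y = εu * bb 1 m0 r x y := by unfold bb; ring
    rw [e1, e2, ← mul_assoc]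
    exact mul_le_mul_of_nonneg_right hle hX
  refine h3.trans (le_trans ?_ h2)
  have : κ * K ≤ κ * (w x) ^ (-κ - 1) := mul_le_mul_of_nonneg_left (hk x hx).2 hκ.le
  exact mul_le_mul this h1 hb0 (by have := (hk x hx).1; positivity)

lemma bb_le_one {ε ξ r x y : ℝ} (hε : 0 ≤ ε) (hε1 : ε ≤ 1) (hr : 0 < r) (hr1 : r ≤ 1) :
    bb ε ξ r x y ≤ 1 := by
  by_cases h : bb ε ξ r x y = 0
  · rw [h]; exact zero_le_one
  obtain ⟨_, _, _, h4, h5⟩ := bb_supp hr h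
  refine (bb_le hε hr h4.le).trans ?_
  have : r ^ 5 ≤ 1 := pow_le_one₀ hr.le hr1
  have h1 : ε * r ^ 5 ≤ 1 := mul_le_one₀ hε1 (by positivity) this
  exact mul_le_one₀ h1 (by linarith) (by linarith)

lemma bb_val {ε ξ r : ℝ} (hr : 0 < r) : bb ε ξ r (ξ - r / 4) (ξ + r / 4) = ε * r ^ 6 / 4 := by
  unfold bb
  rw [max_eq_left, max_eq_left]
  · ring
  · have : 0 < r ^ 2 := by positivity
    nlinarith
  · have : 0 < r ^ 2 := by positivity
    ring_nf; linarith

lemma thetaineq {α β ν θ p : ℝ} (hα : 0 < α) (hβ : 0 < β) (hν : 0 < ν) (e2 : β * p = α + 1)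
    (h : 2 * ν + α ≤ (α + 1) * θ) : 2 + 1 / (ν / α) ≤ θ * p / (ν / β) := by
  have h1 : θ * p / (ν / β) = (α + 1) * θ / ν := by
    rw [← e2]; field_simp
  rw [h1, le_div_iff₀ hν]
  have : (2 + 1 / (ν / α)) * ν = 2 * ν + α := by field_simp
  linarith

lemma no_blow {n : ℕ} {R T p q d1 d2 α β ρ0 : ℝ} {u v : ℝ → ℝ → ℝ}
    (H : Sys n R T p q d1 d2 α β u v) (hρ : ρ0 ∈ Ioo (0:ℝ) R)
    (hunb : ∀ M, ∃ t ∈ Ioo 0 T, M < u t ρ0 + v t ρ0) : False := by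
  obtain ⟨hρ0, hρR⟩ := hρ
  have hα := H.hα
  have hβ := H.hβ
  obtain ⟨ts, c, hts, htsT, hc, hlow⟩ := lower H (ρ1 := 3 * ρ0 / 4) (by linarith) (by linarith) hρR hunb
  obtain ⟨C1, hC1, hu1⟩ := upper H (b := ρ0 / 4) (by linarith) (by linarith)
  obtain ⟨C2, hC2, hv1⟩ := upper H.symm (b := ρ0 / 4) (by linarith) (by linarith)
  obtain ⟨C, hCd⟩ : ∃ C, C = max (max C1 C2) c := ⟨_, rfl⟩
  have hC1' : C1 ≤ C := by rw [hCd]; exact (le_max_left _ _).trans (le_max_left _ _)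
  have hC2' : C2 ≤ C := by rw [hCd]; exact (le_max_right _ _).trans (le_max_left _ _)
  have hcC : c ≤ C := by rw [hCd]; exact le_max_right _ _
  have hC : 0 < C := by linarith
  -- bounds
  have bd : ∀ t ∈ Ico ts T, ∀ x ∈ Icc (ρ0 / 4) (3 * ρ0 / 4),
      ((c / (T - t)) ^ α ≤ u t x ∧ u t x ≤ (C / (T - t)) ^ α) ∧
      ((c / (T - t)) ^ β ≤ v t x ∧ v t x ≤ (C / (T - t)) ^ β) := by
    intro t ht x hx
    have ht' : t ∈ Ico 0 T := ⟨hts.le.trans ht.1, ht.2⟩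
    have hl : 0 < T - t := by linarith [ht.2]
    have hxI : x ∈ Icc 0 R := ⟨by linarith [hx.1], by linarith [hx.2]⟩
    have haI : ρ0 / 4 ∈ Icc 0 R := ⟨by linarith, by linarith⟩
    have h1I : 3 * ρ0 / 4 ∈ Icc 0 R := ⟨by linarith, by linarith⟩
    obtain ⟨l1, l2⟩ := hlow t ht
    have a1 := H.U.mono t ht' haI hxI hx.1
    have a2 := H.U.mono t ht' hxI h1I hx.2
    have a3 := H.V.mono t ht' haI hxI hx.1
    have a4 := H.V.mono t ht' hxI h1I hx.2
    have b1 : (C1 / (T - t)) ^ α ≤ (C / (T - t)) ^ α := by gcongr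
    have b2 : (C2 / (T - t)) ^ β ≤ (C / (T - t)) ^ β := by gcongr
    exact ⟨⟨l1.trans a2, a1.trans ((hu1 t ht').trans b1)⟩, ⟨l2.trans a4, a3.trans ((hv1 t ht').trans b2)⟩⟩
  obtain ⟨ν, hν, hν2, hn1, hn2⟩ := choose_nu (a := α) (b := β) (k := c / C) (by positivity)
  have htsI : ts ∈ Ioo 0 T := ⟨hts, htsT⟩
  have h1I : 3 * ρ0 / 4 ∈ Ioo 0 R := ⟨by linarith, by linarith⟩
  have hmI : ρ0 / 2 ∈ Ioo 0 R := ⟨by linarith, by linarith⟩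
  have pos1 : ∀ t ∈ Ico ts T, ∀ x ∈ Icc (ρ0 / 4) (3 * ρ0 / 4), 0 < u t x ∧ 0 < v t x := by
    intro t ht x hx
    have hl : 0 < T - t := by linarith [ht.2]
    obtain ⟨⟨h1, _⟩, ⟨h2, _⟩⟩ := bd t ht x hx
    exact ⟨lt_of_lt_of_le (by positivity) h1, lt_of_lt_of_le (by positivity) h2⟩
  have hts' : ts ∈ Ico ts T := ⟨le_rfl, htsT⟩
  have pp := pos1 ts hts' (3 * ρ0 / 4) ⟨by linarith, le_rfl⟩
  obtain ⟨su, hsu, hsu'⟩ := strict0 H.U htsI h1I pp.1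
  obtain ⟨sv, hsv, hsv'⟩ := strict0 H.V htsI h1I pp.2
  have hIoo : ∀ x ∈ Ioo 0 R, x ∈ Icc 0 R := fun x hx => ⟨hx.1.le, hx.2.le⟩
  have hIt : ∀ x ∈ Ioo 0 T, x ∈ Ico 0 T := fun x hx => ⟨hx.1.le, hx.2⟩
  obtain ⟨ru, hru, hsru⟩ := strict1 H.U (by
    intro t ht x hx y hy hxy
    exact Real.rpow_le_rpow (H.V.nn t (hIt t ht) y (hIoo y hy))
      (H.V.mono t (hIt t ht) (hIoo x hx) (hIoo y hy) hxy) (by linarith [H.hp])) htsI hsu hmI hsu'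
  obtain ⟨rv, hrv, hsrv⟩ := strict1 H.V (by
    intro t ht x hx y hy hxy
    exact Real.rpow_le_rpow (H.U.nn t (hIt t ht) y (hIoo y hy))
      (H.U.mono t (hIt t ht) (hIoo x hx) (hIoo y hy) hxy) (by linarith [H.hq])) htsI hsv hmI hsv'
  obtain ⟨r, hr, hr1, hr2, hr3, hr4⟩ : ∃ r : ℝ, 0 < r ∧ r ≤ ru ∧ r ≤ rv ∧ r ≤ ρ0 / 8 ∧ r ≤ 1 :=
    ⟨min (min ru rv) (min (ρ0 / 8) 1), by positivity, (min_le_left _ _).trans (min_le_left _ _),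
      (min_le_left _ _).trans (min_le_right _ _), (min_le_right _ _).trans (min_le_left _ _),
      (min_le_right _ _).trans (min_le_right _ _)⟩
  obtain ⟨lu, hlu, qu⟩ := quant (n := n) (p := p) (d := d1) (ρa := ρ0 / 4) (r := r) hα hβ
    (by linarith [H.hp]) H.e2 hc hC hν hν2 H.U.hd
  obtain ⟨lv, hlv, qv⟩ := quant (n := n) (p := q) (d := d2) (ρa := ρ0 / 4) (r := r) hβ hα
    (by linarith [H.hq]) H.e1 hc hC hν hν2 H.V.hd
  obtain ⟨l0, hl0, hl1, hl2, hl3⟩ : ∃ l : ℝ, 0 < l ∧ l ≤ lu ∧ l ≤ lv ∧ l ≤ (T - ts) / 2 := by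
    have : 0 < (T - ts) / 2 := by linarith
    exact ⟨min (min lu lv) ((T - ts) / 2), by positivity, (min_le_left _ _).trans (min_le_left _ _),
      (min_le_left _ _).trans (min_le_right _ _), min_le_right _ _⟩
  obtain ⟨t0, ht0d⟩ : ∃ t0, t0 = T - l0 := ⟨_, rfl⟩
  have ht0I : t0 ∈ Ioo ts T := ⟨by linarith, by linarith⟩
  obtain ⟨εu, hεu, hiu⟩ := hsru r hr hr1 t0 ht0I
  obtain ⟨εv, hεv, hiv⟩ := hsrv r hr hr2 t0 ht0I
  have hκ : 0 < ν / α := by positivity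
  have hκ' : 0 < ν / β := by positivity
  obtain ⟨Ku, hKu⟩ : ∃ K, K = (C / l0) ^ (-ν - α) := ⟨_, rfl⟩
  obtain ⟨Kv, hKv⟩ : ∃ K, K = (C / l0) ^ (-ν - β) := ⟨_, rfl⟩
  have hKu0 : 0 < Ku := by rw [hKu]; positivity
  have hKv0 : 0 < Kv := by rw [hKv]; positivity
  obtain ⟨ε, hε, hε1, hεu', hεv'⟩ : ∃ ε : ℝ, 0 < ε ∧ ε ≤ 1 ∧ ε ≤ ν / α * Ku * εu ∧ ε ≤ ν / β * Kv * εv :=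
    ⟨min 1 (min (ν / α * Ku * εu) (ν / β * Kv * εv)), by positivity, min_le_left _ _,
      (min_le_right _ _).trans (min_le_left _ _), (min_le_right _ _).trans (min_le_right _ _)⟩
  have hsub : ∀ t, t0 ≤ t → t < T → t ∈ Ico ts T := fun t h1 h2 => ⟨by linarith [ht0I.1], h2⟩
  have i1 := init_side (w := u t0) (ρa := ρ0 / 4) (ρ1 := 3 * ρ0 / 4) (R := R) (ε := ε) (κ := ν / α) (K := Ku)
    (by linarith) (by linarith) hε.le hεu hκ hKu0 hεu' hiu (by
      intro x hx
      have ht := hsub t0 le_rfl ht0I.2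
      obtain ⟨⟨b1, b2⟩, ⟨b3, b4⟩⟩ := bd t0 ht x hx
      have e : T - t0 = l0 := by linarith
      rw [e] at b1 b2 b3 b4
      refine ⟨(pos1 t0 ht x hx).1, ?_⟩
      rw [hKu]; exact (qu l0 _ _ hl0 hl1 b1 b2 b3).2.1)
  have i2 := init_side (w := v t0) (ρa := ρ0 / 4) (ρ1 := 3 * ρ0 / 4) (R := R) (ε := ε) (κ := ν / β) (K := Kv)
    (by linarith) (by linarith) hε.le hεv hκ' hKv0 hεv' hiv (by
      intro x hx
      have ht := hsub t0 le_rfl ht0I.2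
      obtain ⟨⟨b1, b2⟩, ⟨b3, b4⟩⟩ := bd t0 ht x hx
      have e : T - t0 = l0 := by linarith
      rw [e] at b1 b2 b3 b4
      refine ⟨(pos1 t0 ht x hx).2, ?_⟩
      rw [hKv]; exact (qv l0 _ _ hl0 hl2 b3 b4 b1).2.1)
  have hθ1 : (c / C) ^ ν ≤ 1 := Real.rpow_le_one (by positivity) (by rw [div_le_one hC]; exact hcC) hν.le
  have key : ∀ t1, t0 < t1 → t1 < T → ε * r ^ 6 / 4 ≤ ((T - t1) / c) ^ ν := by
    intro t1 h01 h1T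
    have hl : 0 < T - t1 := by linarith
    obtain ⟨Λ, hΛ1, hΛ2⟩ : ∃ Λ,
        LL n d1 (ρ0 / 4) r + 8 * d1 * ((ν / α + 1) / (ν / α)) * r ^ 4 * (C / (T - t1)) ^ ν < Λ ∧
        LL n d2 (ρ0 / 4) r + 8 * d2 * ((ν / β + 1) / (ν / β)) * r ^ 4 * (C / (T - t1)) ^ ν < Λ := by
      refine ⟨max _ _ + 1, lt_of_le_of_lt (le_max_left _ _) (lt_add_one _),
        lt_of_le_of_lt (le_max_right _ _) (lt_add_one _)⟩
    have hd1 := H.U.hd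
    have hd2 := H.V.hd
    have hCm : ∀ t ∈ Icc t0 t1, (C / (T - t)) ^ ν ≤ (C / (T - t1)) ^ ν := by
      intro t ht
      have h2 : T - t1 ≤ T - t := by linarith [ht.2]
      have h3 : 0 < T - t := by linarith
      have : C / (T - t) ≤ C / (T - t1) := div_le_div_of_nonneg_left hC.le hl h2
      exact Real.rpow_le_rpow (by positivity) this hν.le
    have fin : ∀ η, 0 < η → ε * r ^ 6 / 4 ≤ ((T - t1) / c) ^ ν + η * Real.exp (Λ * (t1 - t0)) := by
      intro η hη
      have st := stage2 H (κ := ν / α) (κ' := ν / β) (θ := (c / C) ^ ν) (ρa := ρ0 / 4) (ρ1 := 3 * ρ0 / 4)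
        (r := r) (ε := ε) (η := η) (Λ1 := Λ) (m0 := ρ0 / 2) (t0 := t0) (t1 := t1) hκ hκ' (by positivity) hθ1
        (thetaineq hα hβ hν H.e2 hn1) (thetaineq hβ hα hν H.e1 hn2) (by linarith) hr hε hε1 hη
        (by linarith) (by linarith) (by linarith) (by linarith [ht0I.1]) h1T
        (fun z _ => bb_le_one hε.le hε1 hr hr4)
        (fun t ht => pos1 t (hsub t ht.1 (by linarith [ht.2])))
        (by
          intro t ht x hx
          have htT : t < T := by linarith [ht.2]
          obtain ⟨⟨b1, b2⟩, ⟨b3, b4⟩⟩ := bd t (hsub t ht.1 htT) x hx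
          refine (qu (T - t) _ _ (by linarith) (by linarith [ht.1]) b1 b2 b3).1 Λ (lt_of_le_of_lt ?_ hΛ1)
          have := hCm t ht
          gcongr)
        (by
          intro t ht x hx
          have htT : t < T := by linarith [ht.2]
          obtain ⟨⟨b1, b2⟩, ⟨b3, b4⟩⟩ := bd t (hsub t ht.1 htT) x hx
          refine (qv (T - t) _ _ (by linarith) (by linarith [ht.1]) b3 b4 b1).1 Λ (lt_of_le_of_lt ?_ hΛ2)
          have := hCm t ht
          gcongr)
        i1 i2 t1 ⟨h01.le, le_rfl⟩ (ρ0 / 2 - r / 4, ρ0 / 2 + r / 4)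
        ⟨⟨⟨by simp only; linarith, by simp only; linarith⟩, ⟨by simp only; linarith, by simp only; linarith⟩⟩,
          show ρ0 / 2 - r / 4 ≤ ρ0 / 2 + r / 4 by linarith⟩
      have st1 := (lt_min_iff.mp st).1
      unfold ff at st1
      simp only at st1
      rw [bb_val hr] at st1
      have ht := hsub t1 h01.le h1T
      have hy : ρ0 / 2 + r / 4 ∈ Icc (ρ0 / 4) (3 * ρ0 / 4) := ⟨by linarith, by linarith⟩
      have hx : ρ0 / 2 - r / 4 ∈ Icc (ρ0 / 4) (3 * ρ0 / 4) := ⟨by linarith, by linarith⟩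
      obtain ⟨⟨b1, b2⟩, ⟨b3, b4⟩⟩ := bd t1 ht _ hy
      have k2 := (qu (T - t1) _ _ hl (by linarith) b1 b2 b3).2.2
      have k3 : 0 < (u t1 (ρ0 / 2 - r / 4)) ^ (-(ν / α)) := Real.rpow_pos_of_pos (pos1 t1 ht _ hx).1 _
      linarith
    apply le_of_forall_pos_le_add
    intro e he
    have hE := Real.exp_pos (Λ * (t1 - t0))
    have := fin (e / Real.exp (Λ * (t1 - t0))) (by positivity)
    rwa [div_mul_cancel₀ _ hE.ne'] at this
  obtain ⟨b, hb⟩ : ∃ b, b = ε * r ^ 6 / 4 := ⟨_, rfl⟩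
  have hb0 : 0 < b := by rw [hb]; positivity
  obtain ⟨l, hl, hlb, hll⟩ : ∃ l : ℝ, 0 < l ∧ l ≤ l0 / 2 ∧ l ≤ c * (b / 2) ^ (1 / ν) :=
    ⟨min (l0 / 2) (c * (b / 2) ^ (1 / ν)), by positivity, min_le_left _ _, min_le_right _ _⟩
  have h1 := key (T - l) (by linarith) (by linarith)
  rw [← hb, sub_sub_cancel] at h1
  have h2 : (l / c) ^ ν ≤ ((b / 2) ^ (1 / ν)) ^ ν := by
    apply Real.rpow_le_rpow (by positivity) _ hν.le
    rw [div_le_iff₀ hc]; linarith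
  rw [← Real.rpow_mul (by positivity), one_div_mul_cancel hν.ne', Real.rpow_one] at h2
  linarith

/-- Single-point blow-up for the model system
`u_t - δ Δu = v^p`, `v_t - Δv = u^q` (written in radial coordinates, `ρ = |x|`)
for radially symmetric, radially nonincreasing nonnegative solutions on the ball of
radius `R` blowing up at time `T`: for every `0 < ρ < R` the quantity
`u(t,ρ) + v(t,ρ)` stays bounded as `t → T`. -/
theorem single_point_blowup_model
    (n : ℕ) (hn : 1 ≤ n) (R : ℝ) (hR : 0 < R)
    (p q δ : ℝ) (hp : 1 < p) (hq : 1 < q) (hδ : 0 < δ)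
    (T : ℝ) (hT : 0 < T)
    (u v : ℝ → ℝ → ℝ)
    (hu_nn : ∀ t ∈ Ico (0:ℝ) T, ∀ ρ ∈ Icc (0:ℝ) R, 0 ≤ u t ρ)
    (hv_nn : ∀ t ∈ Ico (0:ℝ) T, ∀ ρ ∈ Icc (0:ℝ) R, 0 ≤ v t ρ)
    (hu_cont : ContinuousOn (Function.uncurry u) (Ico (0:ℝ) T ×ˢ Icc (0:ℝ) R))
    (hv_cont : ContinuousOn (Function.uncurry v) (Ico (0:ℝ) T ×ˢ Icc (0:ℝ) R))
    (hu_regx : ∀ t ∈ Ioo (0:ℝ) T, ContDiffOn ℝ 2 (u t) (Ioo (0:ℝ) R))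
    (hv_regx : ∀ t ∈ Ioo (0:ℝ) T, ContDiffOn ℝ 2 (v t) (Ioo (0:ℝ) R))
    (hu_regt : ∀ ρ ∈ Ioo (0:ℝ) R, ∀ t ∈ Ioo (0:ℝ) T, DifferentiableAt ℝ (fun s => u s ρ) t)
    (hv_regt : ∀ ρ ∈ Ioo (0:ℝ) R, ∀ t ∈ Ioo (0:ℝ) T, DifferentiableAt ℝ (fun s => v s ρ) t)
    (hu_bc : ∀ t ∈ Ioo (0:ℝ) T, u t R = 0)
    (hv_bc : ∀ t ∈ Ioo (0:ℝ) T, v t R = 0)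
    (hu_mono : ∀ t ∈ Ico (0:ℝ) T, AntitoneOn (u t) (Icc (0:ℝ) R))
    (hv_mono : ∀ t ∈ Ico (0:ℝ) T, AntitoneOn (v t) (Icc (0:ℝ) R))
    (hu_pde : ∀ t ∈ Ioo (0:ℝ) T, ∀ ρ ∈ Ioo (0:ℝ) R,
      deriv (fun s => u s ρ) t
        = δ * (deriv (deriv (u t)) ρ + ((n : ℝ) - 1) / ρ * deriv (u t) ρ) + v t ρ ^ p)
    (hv_pde : ∀ t ∈ Ioo (0:ℝ) T, ∀ ρ ∈ Ioo (0:ℝ) R,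
      deriv (fun s => v s ρ) t
        = deriv (deriv (v t)) ρ + ((n : ℝ) - 1) / ρ * deriv (v t) ρ + u t ρ ^ q)
    (hblow : ∀ M : ℝ, ∀ ε > (0:ℝ), ∃ t, T - ε < t ∧ t < T ∧ M < u t 0 + v t 0) :
    ∀ ρ ∈ Ioo (0:ℝ) R, ∃ C : ℝ, ∀ t ∈ Ioo (0:ℝ) T, u t ρ + v t ρ ≤ C := by
  have hpq : 0 < p * q - 1 := by nlinarith
  have radof : ∀ (d : ℝ) (w S : ℝ → ℝ → ℝ), 0 < d →
      (∀ t ∈ Ico (0:ℝ) T, ∀ ρ ∈ Icc (0:ℝ) R, 0 ≤ w t ρ) →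
      ContinuousOn (Function.uncurry w) (Ico (0:ℝ) T ×ˢ Icc (0:ℝ) R) →
      (∀ t ∈ Ioo (0:ℝ) T, ContDiffOn ℝ 2 (w t) (Ioo (0:ℝ) R)) →
      (∀ ρ ∈ Ioo (0:ℝ) R, ∀ t ∈ Ioo (0:ℝ) T, DifferentiableAt ℝ (fun s => w s ρ) t) →
      (∀ t ∈ Ioo (0:ℝ) T, w t R = 0) →
      (∀ t ∈ Ico (0:ℝ) T, AntitoneOn (w t) (Icc (0:ℝ) R)) →
      (∀ t ∈ Ioo (0:ℝ) T, ∀ ρ ∈ Ioo (0:ℝ) R,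
        deriv (fun s => w s ρ) t
          = d * (deriv (deriv (w t)) ρ + ((n : ℝ) - 1) / ρ * deriv (w t) ρ) + S t ρ) →
      Rad n R T d w S := by
    intro d w S hd h1 h2 h3 h4 h5 h6 h7
    refine ⟨hd, hn, hR, h1, h2, ?_, ?_, ?_, h5, h6⟩
    · intro t ht x hx
      exact (((h3 t ht).differentiableOn (by norm_num)).differentiableAt
        (isOpen_Ioo.mem_nhds hx)).hasDerivAt
    · intro t ht x hx
      have h := (h3 t ht).deriv_of_isOpen (m := 1) isOpen_Ioo (by norm_num)
      exact ((h.differentiableOn (by norm_num)).differentiableAt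
        (isOpen_Ioo.mem_nhds hx)).hasDerivAt
    · intro t ht x hx
      rw [← h7 t ht x hx]
      exact (h4 x hx t ht).hasDerivAt
  have H : Sys n R T p q δ 1 ((p + 1) / (p * q - 1)) ((q + 1) / (p * q - 1)) u v := by
    refine ⟨hT, hp, hq, by positivity, by positivity, by rw [div_mul_eq_mul_div, div_add_one hpq.ne']; congr 1; ring,
      by rw [div_mul_eq_mul_div, div_add_one hpq.ne']; congr 1; ring, ?_, ?_⟩
    · exact radof δ u _ hδ hu_nn hu_cont hu_regx hu_regt hu_bc hu_mono hu_pde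
    · refine radof 1 v _ one_pos hv_nn hv_cont hv_regx hv_regt hv_bc hv_mono ?_
      intro t ht x hx
      rw [one_mul]; exact hv_pde t ht x hx
  intro ρ hρ
  by_contra! hcon
  exact no_blow H hρ hcon
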